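/- Let n ≥ 1 and k ≥ 1 be integers. Suppose there exists a homogeneous polynomial s of degree k in ℂ[z_0, …, z_n] such that the hypersurface D = {s = 0} ⊆ ℙⁿ(ℂ) is smooth and Brody hyperbolic and such that the complement ℙⁿ(ℂ)∖D is Brody hyperbolic. Let δ be a multiple of k with δ ≥ (n + 2)k. Then there exists a homogeneous polynomial G ∈ ℂ[z_0, …, z_n] of degree δ such that the hypersurface W = {z_{n+1}^{δ} = G(z_0, …, z_n)} ⊆ ℙ^{n+1}(ℂ) is smooth and Brody hyperbolic. -/

import Mathlib

open MvPolynomial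

/-- The hypersurface `{F = 0} ⊆ ℙ^{q-1}(ℂ)` is Brody hyperbolic. -/
def IsBrodyHyperbolicHypersurface {q : ℕ} (F : MvPolynomial (Fin q) ℂ) : Prop :=
  ∀ f : Fin q → ℂ → ℂ,
    (∀ i, Differentiable ℂ (f i)) →
    (∀ z : ℂ, ∃ i, f i z ≠ 0) →
    (∀ z : ℂ, MvPolynomial.eval (fun i => f i z) F = 0) →
    ∃ (c : Fin q → ℂ) (u : ℂ → ℂ), Differentiable ℂ u ∧ ∀ i z, f i z = c i * u z

/-- The complement `ℙ^{q-1}(ℂ) ∖ {F = 0}` is Brody hyperbolic. -/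
def IsBrodyHyperbolicComplement {q : ℕ} (F : MvPolynomial (Fin q) ℂ) : Prop :=
  ∀ f : Fin q → ℂ → ℂ,
    (∀ i, Differentiable ℂ (f i)) →
    (∀ z : ℂ, ∃ i, f i z ≠ 0) →
    (∀ z : ℂ, MvPolynomial.eval (fun i => f i z) F ≠ 0) →
    ∃ (c : Fin q → ℂ) (u : ℂ → ℂ), Differentiable ℂ u ∧ ∀ i z, f i z = c i * u z

/-- The hypersurface `{F = 0} ⊆ ℙ^{q-1}(ℂ)` is smooth. -/
def IsSmoothHypersurface {q : ℕ} (F : MvPolynomial (Fin q) ℂ) : Prop :=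
  ∀ x : Fin q → ℂ, x ≠ 0 → MvPolynomial.eval x F = 0 →
    ∃ i, MvPolynomial.eval x (MvPolynomial.pderiv i F) ≠ 0

section

open Filter Topology Metric ComplexConjugate

/-- The matrix of the orthogonal projection onto the line spanned by `v`. -/
noncomputable def lineProj {ι : Type*} [Fintype ι] (v : ι → ℂ) : ι → ι → ℂ :=
  fun j l => v j * conj (v l) / ∑ i, v i * conj (v i)

section LineProj

variable {ι : Type*} [Fintype ι]

lemma sum_mul_conj_eq (v : ι → ℂ) :
    ∑ i, v i * conj (v i) = ((∑ i, ‖v i‖ ^ 2 : ℝ) : ℂ) := by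
  push_cast
  exact Finset.sum_congr rfl fun i _ => Complex.mul_conj' (v i)

lemma sum_norm_sq_pos {v : ι → ℂ} (hv : v ≠ 0) : 0 < ∑ i, ‖v i‖ ^ 2 := by
  obtain ⟨i, hi⟩ := Function.ne_iff.1 hv
  exact Finset.sum_pos' (fun _ _ => by positivity)
    ⟨i, Finset.mem_univ i, by have : v i ≠ 0 := hi; positivity⟩

lemma sum_mul_conj_ne_zero {v : ι → ℂ} (hv : v ≠ 0) : ∑ i, v i * conj (v i) ≠ 0 := by
  rw [sum_mul_conj_eq]
  exact_mod_cast (sum_norm_sq_pos hv).ne'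

lemma lineProj_smul {c : ℂ} (hc : c ≠ 0) (v : ι → ℂ) : lineProj (c • v) = lineProj v := by
  funext j l
  have hc' : conj c ≠ 0 := by simpa using hc
  have h : ∑ i, c * v i * (conj c * conj (v i)) = (c * conj c) * ∑ i, v i * conj (v i) := by
    rw [Finset.mul_sum]
    exact Finset.sum_congr rfl fun i _ => by ring
  simp only [lineProj, Pi.smul_apply, smul_eq_mul, map_mul, h]
  rw [show c * v j * (conj c * conj (v l)) = (c * conj c) * (v j * conj (v l)) by ring,
    mul_div_mul_left _ _ (mul_ne_zero hc hc')]

lemma sum_lineProj_diag {v : ι → ℂ} (hv : v ≠ 0) : ∑ i, lineProj v i i = 1 := by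
  simp only [lineProj]
  rw [← Finset.sum_div, div_self (sum_mul_conj_ne_zero hv)]

lemma lineProj_mul_diag (v : ι → ℂ) (i j l : ι) :
    lineProj v j l * lineProj v i i = lineProj v j i * lineProj v i l := by
  simp only [lineProj]
  ring

lemma lineProj_conj (v : ι → ℂ) (j l : ι) : lineProj v l j = conj (lineProj v j l) := by
  simp only [lineProj, map_div₀, map_mul, Complex.conj_conj, map_sum]
  simp only [mul_comm]

lemma lineProj_diag_ne_zero {v : ι → ℂ} {i : ι} (h : lineProj v i i ≠ 0) : v i ≠ 0 := by
  rintro h0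
  simp [lineProj, h0] at h

lemma lineProj_div_diag {v : ι → ℂ} {i : ι} (h : lineProj v i i ≠ 0) (j : ι) :
    lineProj v j i / lineProj v i i = v j / v i := by
  have hi := lineProj_diag_ne_zero h
  have hc : conj (v i) ≠ 0 := by simpa using hi
  have hv : v ≠ 0 := fun h0 => hi (by simp [h0])
  have := sum_mul_conj_ne_zero hv
  simp only [lineProj]
  field_simp

lemma norm_lineProj_le (v : ι → ℂ) (j l : ι) : ‖lineProj v j l‖ ≤ 1 := by
  by_cases hv : v = 0
  · simp [lineProj, hv]
  have hpos := sum_norm_sq_pos hv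
  simp only [lineProj]
  rw [sum_mul_conj_eq, norm_div, norm_mul, Complex.norm_conj, Complex.norm_real,
    Real.norm_of_nonneg hpos.le, div_le_one hpos]
  have h1 : ‖v j‖ ^ 2 ≤ ∑ i, ‖v i‖ ^ 2 :=
    Finset.single_le_sum (f := fun i => ‖v i‖ ^ 2) (fun _ _ => by positivity) (Finset.mem_univ j)
  have h2 : ‖v l‖ ^ 2 ≤ ∑ i, ‖v i‖ ^ 2 :=
    Finset.single_le_sum (f := fun i => ‖v i‖ ^ 2) (fun _ _ => by positivity) (Finset.mem_univ l)
  nlinarith [sq_nonneg (‖v j‖ - ‖v l‖)]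

lemma contDiffAt_lineProj {v : ι → ℂ} (hv : v ≠ 0) : ContDiffAt ℝ 1 (lineProj (ι := ι)) v := by
  have hp : ∀ i, ContDiffAt ℝ 1 (fun w : ι → ℂ => w i) v := fun i =>
    (ContinuousLinearMap.proj (R := ℝ) (φ := fun _ : ι => ℂ) i).contDiff.contDiffAt
  have hc : ∀ i, ContDiffAt ℝ 1 (fun w : ι → ℂ => conj (w i)) v := fun i =>
    (Complex.conjCLE.contDiff.contDiffAt).comp v (hp i)
  refine contDiffAt_pi.2 fun j => contDiffAt_pi.2 fun l => ?_
  simp only [lineProj]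
  have hs : ContDiffAt ℝ 1 (fun w : ι → ℂ => ∑ i, w i * conj (w i)) v :=
    ContDiffAt.sum fun i _ => (hp i).mul (hc i)
  simp only [div_eq_mul_inv]
  exact ((hp j).mul (hc l)).mul (hs.inv (sum_mul_conj_ne_zero hv))

lemma contDiff_lineProj_comp {h : ι → ℂ → ℂ} (hd : ∀ i, Differentiable ℂ (h i))
    (h0 : ∀ z, ∃ i, h i z ≠ 0) : ContDiff ℝ 1 (fun z => lineProj fun i => h i z) := by
  refine contDiff_iff_contDiffAt.2 fun z => ?_
  have hv : (fun i => h i z) ≠ 0 := by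
    obtain ⟨i, hi⟩ := h0 z
    exact fun h => hi (congrFun h i)
  refine ContDiffAt.comp (f := fun z i => h i z) z (contDiffAt_lineProj hv) (contDiffAt_pi.2 fun i => ?_)
  exact ((hd i).contDiff.restrict_scalars ℝ).contDiffAt

/-- A tuple of entire functions whose projective derivative vanishes is constant. -/
lemma exists_const_mul_of_fderiv_lineProj_eq_zero {h : ι → ℂ → ℂ}
    (hd : ∀ i, Differentiable ℂ (h i)) (h0 : ∀ z, ∃ i, h i z ≠ 0)
    (hf : ∀ z, fderiv ℝ (fun z => lineProj fun i => h i z) z = 0) :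
    ∃ (c : ι → ℂ) (u : ℂ → ℂ), Differentiable ℂ u ∧ ∀ i z, h i z = c i * u z := by
  have hv : ∀ z, (fun i => h i z) ≠ 0 := fun z => by
    obtain ⟨i, hi⟩ := h0 z
    exact fun h => hi (congrFun h i)
  have hconst : ∀ z, lineProj (fun i => h i z) = lineProj (fun i => h i 0) := fun z =>
    is_const_of_fderiv_eq_zero ((contDiff_lineProj_comp hd h0).differentiable one_ne_zero) hf z 0
  obtain ⟨l, hl⟩ : ∃ l, lineProj (fun i => h i 0) l l ≠ 0 := by
    by_contra! hcon
    have := sum_lineProj_diag (hv 0)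
    simp [hcon] at this
  refine ⟨fun j => h j 0 / h l 0, h l, hd l, fun j z => ?_⟩
  have h1 := lineProj_div_diag hl j
  have hlz : lineProj (fun i => h i z) l l ≠ 0 := by rw [hconst z]; exact hl
  have h2 := lineProj_div_diag hlz j
  rw [hconst z, h1] at h2
  have := lineProj_diag_ne_zero hlz
  simp only at h2 this ⊢
  rw [h2]
  field_simp

end LineProj

/-- Brody's reparametrization: a nonconstant entire curve in projective space can be rescaled
to have unit derivative at the origin and derivative at most `2` on a large disc. -/
lemma exists_brody_reparametrization {ι : Type*} [Fintype ι] {h : ι → ℂ → ℂ}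
    (hd : ∀ i, Differentiable ℂ (h i)) (h0 : ∀ z, ∃ i, h i z ≠ 0)
    (hnc : ¬ ∃ (c : ι → ℂ) (u : ℂ → ℂ), Differentiable ℂ u ∧ ∀ i z, h i z = c i * u z)
    {R : ℝ} (hR : 0 < R) :
    ∃ a b : ℂ, ‖fderiv ℝ (fun z => lineProj fun i => h i (a + b * z)) 0‖ = 1 ∧
      ∀ z, ‖z‖ ≤ R → ‖fderiv ℝ (fun z => lineProj fun i => h i (a + b * z)) z‖ ≤ 2 := by
  set Φ : ℂ → ι → ι → ℂ := fun z => lineProj fun i => h i z with hΦ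
  have hC : ContDiff ℝ 1 Φ := contDiff_lineProj_comp hd h0
  set φ : ℂ → ℝ := fun z => ‖fderiv ℝ Φ z‖ with hφ
  have hφc : Continuous φ := (hC.continuous_fderiv one_ne_zero).norm
  obtain ⟨z₀, hz₀⟩ : ∃ z, 0 < φ z := by
    by_contra! hcon
    exact hnc (exists_const_mul_of_fderiv_lineProj_eq_zero hd h0 fun z =>
      norm_le_zero_iff.1 (hcon z))
  set T := 2 * R / φ z₀ with hT
  have hTpos : 0 < T := by positivity
  obtain ⟨a, ha, hmax⟩ := (isCompact_closedBall z₀ T).exists_isMaxOn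
    ⟨z₀, mem_closedBall_self hTpos.le⟩
    (f := fun z => (T - dist z z₀) * φ z) (by fun_prop)
  have hmax' : ∀ z ∈ closedBall z₀ T, (T - dist z z₀) * φ z ≤ (T - dist a z₀) * φ a :=
    fun z hz => hmax hz
  have hM : 2 * R ≤ (T - dist a z₀) * φ a := by
    have := hmax' z₀ (mem_closedBall_self hTpos.le)
    rw [dist_self, sub_zero, hT, div_mul_cancel₀ _ hz₀.ne'] at this
    exact this
  have hρ0 : 0 ≤ T - dist a z₀ := sub_nonneg.2 ha
  have hφa : 0 < φ a := by
    rcases (norm_nonneg (fderiv ℝ Φ a)).eq_or_lt with h | h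
    · have : φ a = 0 := h.symm
      rw [this] at hM
      linarith
    · exact h
  have hρ : 0 < T - dist a z₀ := by
    rcases hρ0.eq_or_lt with h | h
    · rw [← h] at hM
      linarith
    · exact h
  set b : ℝ := 1 / φ a with hb
  have hbpos : 0 < b := by positivity
  have hbφ : b * φ a = 1 := one_div_mul_cancel hφa.ne'
  have hder : ∀ z : ℂ, fderiv ℝ (fun z => lineProj fun i => h i (a + (b : ℂ) * z)) z =
      b • fderiv ℝ Φ (a + b * z) := by
    intro z
    have h1 : HasFDerivAt (𝕜 := ℝ) (fun z : ℂ => a + (b : ℂ) * z)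
        (b • ContinuousLinearMap.id ℝ ℂ) z := by
      have := ((hasFDerivAt_id (𝕜 := ℝ) z).const_smul b).const_add a
      simpa using! this
    have h2 : HasFDerivAt Φ (fderiv ℝ Φ (a + b * z)) (a + b * z) :=
      (hC.differentiable one_ne_zero _).hasFDerivAt
    have h3 := (h2.comp z h1).fderiv
    rw [ContinuousLinearMap.comp_smul, ContinuousLinearMap.comp_id] at h3
    exact h3
  refine ⟨a, b, ?_, fun z hz => ?_⟩
  · rw [hder, norm_smul, Real.norm_of_nonneg hbpos.le, mul_zero, add_zero]
    exact hbφ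
  · rw [hder, norm_smul, Real.norm_of_nonneg hbpos.le]
    change b * φ (a + b * z) ≤ 2
    have hdist : dist (a + b * z) a ≤ (T - dist a z₀) / 2 := by
      rw [dist_eq_norm, add_sub_cancel_left, norm_mul, Complex.norm_real,
        Real.norm_of_nonneg hbpos.le]
      have h4 : b * (2 * R) ≤ b * ((T - dist a z₀) * φ a) := mul_le_mul_of_nonneg_left hM hbpos.le
      have h5 : b * ((T - dist a z₀) * φ a) = T - dist a z₀ := by
        rw [mul_left_comm, hbφ, mul_one]
      have h6 : b * ‖z‖ ≤ b * R := mul_le_mul_of_nonneg_left hz hbpos.le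
      linarith
    have htri := dist_triangle (a + b * z) a z₀
    have h1 := hmax' (a + b * z) (by rw [mem_closedBall]; linarith)
    have h2 : (T - dist a z₀) / 2 * φ (a + b * z) ≤ (T - dist a z₀) * φ a :=
      (mul_le_mul_of_nonneg_right (by linarith) (norm_nonneg _)).trans h1
    have h3 : φ (a + b * z) ≤ 2 * φ a := by
      refine le_of_mul_le_mul_left ?_ hρ
      linarith
    calc b * φ (a + b * z) ≤ b * (2 * φ a) := mul_le_mul_of_nonneg_left h3 hbpos.le
      _ = 2 := by rw [mul_left_comm, hbφ, mul_one]

section Limits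

variable {E : Type*} [PseudoMetricSpace E]

/-- Continuous convergence is locally uniform convergence. -/
lemma tendstoLocallyUniformlyOn_of_tendsto_prod {α : Type*} {l : Filter α} {f : α → ℂ → E}
    {F : ℂ → E} {s : Set ℂ} (hF : ∀ z ∈ s, ContinuousAt F z)
    (h : ∀ z ∈ s, Tendsto (fun q : α × ℂ => f q.1 q.2) (l ×ˢ 𝓝 z) (𝓝 (F z))) :
    TendstoLocallyUniformlyOn f F l s := by
  rw [tendstoLocallyUniformlyOn_iff_filter]
  intro z hz
  rw [tendstoUniformlyOnFilter_iff_tendsto]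
  have h1 : Tendsto (fun q : α × ℂ => (F q.2, f q.1 q.2)) (l ×ˢ 𝓝 z) (𝓝 (F z, F z)) :=
    (Tendsto.comp (hF z hz) tendsto_snd).prodMk_nhds (h z hz)
  exact (h1.mono_right (nhds_le_uniformity _)).mono_left
    (Filter.prod_mono_right _ nhdsWithin_le_nhds)

lemma TendstoLocallyUniformlyOn.tendsto_prod {α : Type*} {l : Filter α} {f : α → ℂ → E}
    {F : ℂ → E} {s : Set ℂ} (hs : IsOpen s) (h : TendstoLocallyUniformlyOn f F l s) {z : ℂ}
    (hz : z ∈ s) (hF : ContinuousAt F z) :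
    Tendsto (fun q : α × ℂ => f q.1 q.2) (l ×ˢ 𝓝 z) (𝓝 (F z)) := by
  rw [tendstoLocallyUniformlyOn_iff_filter] at h
  have h1 := tendstoUniformlyOnFilter_iff_tendsto.1 (h z hz)
  rw [hs.nhdsWithin_eq hz] at h1
  have h2 : Tendsto (fun q : α × ℂ => F q.2) (l ×ˢ 𝓝 z) (𝓝 (F z)) := Tendsto.comp hF tendsto_snd
  exact (Uniform.tendsto_congr h1).1 h2

lemma exists_ball_eventually_of_prod {α : Type*} {l : Filter α} {P : α → ℂ → Prop} {p : ℂ}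
    (h : ∀ᶠ q : α × ℂ in l ×ˢ 𝓝 p, P q.1 q.2) :
    ∃ r > 0, ∀ᶠ a in l, ∀ z ∈ ball p r, P a z := by
  obtain ⟨A, hA, B, hB, hAB⟩ := eventually_prod_iff.1 h
  obtain ⟨r, hr, hr'⟩ := Metric.eventually_nhds_iff_ball.1 hB
  exact ⟨r, hr, hA.mono fun a ha z hz => hAB ha (hr' z hz)⟩

lemma exists_tendsto_prod_of_lipschitz [ProperSpace E] (U : Ultrafilter ℕ) {f : ℕ → ℂ → E}
    {x₀ : E} (hb : ∀ n z, dist (f n z) x₀ ≤ 1)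
    (hl : ∀ R : ℝ, ∀ᶠ n in U, ∀ z ∈ closedBall (0 : ℂ) R, ∀ w ∈ closedBall (0 : ℂ) R,
      dist (f n z) (f n w) ≤ 2 * dist z w) :
    ∃ F : ℂ → E, Continuous F ∧
      ∀ z, Tendsto (fun q : ℕ × ℂ => f q.1 q.2) (↑U ×ˢ 𝓝 z) (𝓝 (F z)) := by
  have hpt : ∀ z, ∃ y, Tendsto (fun n => f n z) U (𝓝 y) := fun z => by
    obtain ⟨y, -, hy⟩ := (isCompact_closedBall x₀ 1).ultrafilter_le_nhds (U.map fun n => f n z)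
      (by
        rw [Ultrafilter.coe_map, le_principal_iff]
        exact Filter.mem_map.2 (Eventually.of_forall fun n => hb n z))
    exact ⟨y, hy⟩
  choose F hF using hpt
  refine ⟨F, ?_, fun z => ?_⟩
  · have : LipschitzWith 2 F := LipschitzWith.of_dist_le_mul fun z w => by
      refine le_of_tendsto ((hF z).dist (hF w)) ?_
      filter_upwards [hl (max ‖z‖ ‖w‖)] with n hn
      exact hn z (by simp) w (by simp)
    exact this.continuous
  · rw [tendsto_iff_dist_tendsto_zero]
    have h1 : Tendsto (fun q : ℕ × ℂ => 2 * dist q.2 z + dist (f q.1 z) (F z)) (↑U ×ˢ 𝓝 z)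
        (𝓝 (2 * 0 + 0)) := by
      refine Tendsto.add (Tendsto.const_mul _ ?_) ?_
      · exact (tendsto_iff_dist_tendsto_zero.1 (tendsto_id (x := 𝓝 z))).comp tendsto_snd
      · exact (tendsto_iff_dist_tendsto_zero.1 (hF z)).comp tendsto_fst
    rw [mul_zero, add_zero] at h1
    refine squeeze_zero' (Eventually.of_forall fun _ => dist_nonneg) ?_ h1
    have h2 : ∀ᶠ w in 𝓝 z, w ∈ closedBall (0 : ℂ) (‖z‖ + 1) := by
      have : closedBall (0 : ℂ) (‖z‖ + 1) ∈ 𝓝 z :=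
        mem_of_superset (isOpen_ball.mem_nhds (by simp)) ball_subset_closedBall
      exact this
    filter_upwards [(hl (‖z‖ + 1)).prod_mk h2] with q hq
    exact (dist_triangle _ (f q.1 z) _).trans
      (add_le_add_left (hq.1 _ hq.2 _ (by simp)) _)

end Limits

/-- A limit of a sequence of entire curves in projective space, recorded by its projection
matrices. -/
structure IsProjectiveLimit {ι : Type*} [Fintype ι] (U : Ultrafilter ℕ) (g : ℕ → ι → ℂ → ℂ)
    (Q : ℂ → ι → ι → ℂ) : Prop where
  continuous : Continuous Q
  sum_diag : ∀ z, ∑ i, Q z i i = 1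
  mul_diag : ∀ z i j l, Q z j l * Q z i i = Q z j i * Q z i l
  conj_eq : ∀ z j l, Q z l j = conj (Q z j l)
  chart : ∀ i p, Q p i i ≠ 0 → ∃ r > 0, (∀ z ∈ ball p r, Q z i i ≠ 0) ∧
    (∀ᶠ ν in U, ∀ z ∈ ball p r, g ν i z ≠ 0) ∧
    ∀ j, DifferentiableOn ℂ (fun z => Q z j i / Q z i i) (ball p r) ∧
      TendstoLocallyUniformlyOn (fun ν z => g ν j z / g ν i z) (fun z => Q z j i / Q z i i)
        U (ball p r)

theorem exists_isProjectiveLimit {ι : Type*} [Fintype ι] (U : Ultrafilter ℕ) {g : ℕ → ι → ℂ → ℂ}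
    (hd : ∀ ν i, Differentiable ℂ (g ν i)) (h0 : ∀ ν z, ∃ i, g ν i z ≠ 0)
    (hl : ∀ R : ℝ, ∀ᶠ ν in U, ∀ z ∈ closedBall (0 : ℂ) R,
      ‖fderiv ℝ (fun z => lineProj fun i => g ν i z) z‖ ≤ 2) :
    ∃ Q : ℂ → ι → ι → ℂ, IsProjectiveLimit U g Q := by
  have hv : ∀ ν z, (fun i => g ν i z) ≠ 0 := fun ν z => by
    obtain ⟨i, hi⟩ := h0 ν z
    exact fun h => hi (congrFun h i)
  obtain ⟨Q, hQc, hQ⟩ := exists_tendsto_prod_of_lipschitz U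
    (f := fun ν z => lineProj fun i => g ν i z) (x₀ := 0)
    (fun ν z => by
      rw [dist_zero_right]
      refine (pi_norm_le_iff_of_nonneg zero_le_one).2 fun j =>
        (pi_norm_le_iff_of_nonneg zero_le_one).2 fun l => norm_lineProj_le _ _ _)
    (fun R => (hl R).mono fun ν hν z hz w hw => by
      rw [dist_eq_norm, dist_eq_norm]
      exact Convex.norm_image_sub_le_of_norm_fderiv_le (𝕜 := ℝ)
        (fun x _ => (contDiff_lineProj_comp (hd ν) (h0 ν)).differentiable one_ne_zero x)
        hν (convex_closedBall 0 R) hw hz)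
  have hQe : ∀ z j l, Tendsto (fun q : ℕ × ℂ => lineProj (fun i => g q.1 i q.2) j l)
      (↑U ×ˢ 𝓝 z) (𝓝 (Q z j l)) := fun z j l =>
    tendsto_pi_nhds.1 (tendsto_pi_nhds.1 (hQ z) j) l
  have hQcont : ∀ j l, Continuous fun z => Q z j l := fun j l => by fun_prop
  refine ⟨Q, hQc, fun z => ?_, fun z i j l => ?_, fun z j l => ?_, fun i p hp => ?_⟩
  · refine tendsto_nhds_unique (tendsto_finsetSum _ fun i _ => hQe z i i) ?_
    simp only [sum_lineProj_diag (hv _ _)]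
    exact tendsto_const_nhds
  · refine tendsto_nhds_unique ((hQe z j l).mul (hQe z i i)) ?_
    simp only [lineProj_mul_diag]
    exact (hQe z j i).mul (hQe z i l)
  · refine tendsto_nhds_unique (hQe z l j) ?_
    simp only [fun q : ℕ × ℂ => lineProj_conj (fun i => g q.1 i q.2) j l]
    exact (Complex.continuous_conj.tendsto _).comp (hQe z j l)
  · obtain ⟨r₁, hr₁, h₁⟩ := exists_ball_eventually_of_prod
      (P := fun ν z => lineProj (fun i => g ν i z) i i ≠ 0) ((hQe p i i).eventually_ne hp)
    obtain ⟨r₂, hr₂, h₂⟩ := Metric.eventually_nhds_iff_ball.1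
      ((hQcont i i).continuousAt.eventually_ne hp)
    have hb₁ : ball p (min r₁ r₂) ⊆ ball p r₁ := ball_subset_ball (min_le_left _ _)
    have hb₂ : ball p (min r₁ r₂) ⊆ ball p r₂ := ball_subset_ball (min_le_right _ _)
    have hne : ∀ᶠ ν in U, ∀ z ∈ ball p (min r₁ r₂), g ν i z ≠ 0 := h₁.mono fun ν hν z hz =>
      lineProj_diag_ne_zero (v := fun i => g ν i z) (hν z (hb₁ hz))
    refine ⟨min r₁ r₂, lt_min hr₁ hr₂, fun z hz => h₂ z (hb₂ hz), hne, fun j => ?_⟩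
    have hT : TendstoLocallyUniformlyOn (fun ν z => g ν j z / g ν i z)
        (fun z => Q z j i / Q z i i) U (ball p (min r₁ r₂)) := by
      refine tendstoLocallyUniformlyOn_of_tendsto_prod (fun z hz =>
        ((hQcont j i).continuousAt).div (hQcont i i).continuousAt (h₂ z (hb₂ hz)))
        fun z hz => ?_
      refine ((hQe z j i).div (hQe z i i) (h₂ z (hb₂ hz))).congr' ?_
      filter_upwards [(hQe z i i).eventually_ne (h₂ z (hb₂ hz))] with q hq
      exact lineProj_div_diag (v := fun i => g q.1 i q.2) hq j
    refine ⟨hT.differentiableOn (hne.mono fun ν hν => ?_) isOpen_ball, hT⟩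
    exact (hd ν j).differentiableOn.div (hd ν i).differentiableOn hν

lemma IsProjectiveLimit.exists_diag_ne_zero {ι : Type*} [Fintype ι] {U : Ultrafilter ℕ}
    {g : ℕ → ι → ℂ → ℂ} {Q : ℂ → ι → ι → ℂ} (hQ : IsProjectiveLimit U g Q) (z : ℂ) :
    ∃ i, Q z i i ≠ 0 := by
  by_contra! hcon
  have := hQ.sum_diag z
  simp [hcon] at this

lemma IsProjectiveLimit.exists_deriv_ne_zero {ι : Type*} [Fintype ι] {U : Ultrafilter ℕ}
    {g : ℕ → ι → ℂ → ℂ} {Q : ℂ → ι → ι → ℂ} (hQ : IsProjectiveLimit U g Q)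
    (hd : ∀ ν i, Differentiable ℂ (g ν i))
    (h1 : ∀ ν, ‖fderiv ℝ (fun z => lineProj fun i => g ν i z) 0‖ = 1)
    {i : ι} (hi : Q 0 i i ≠ 0) :
    ∃ j, deriv (fun z => Q z j i / Q z i i) 0 ≠ 0 := by
  by_contra! hcon
  obtain ⟨r, hr, hne, hgne, hch⟩ := hQ.chart i 0 hi
  have hmem : (0 : ℂ) ∈ ball (0 : ℂ) r := mem_ball_self hr
  set y : ℕ → ℂ → ι → ℂ := fun ν z j => g ν j z / g ν i z with hy
  set A : ι → ℂ := fun j => Q 0 j i / Q 0 i i with hA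
  have hA0 : A ≠ 0 := fun h => by
    have := congrFun h i
    simp [hA, hi] at this
  have hyA : Tendsto (fun ν => y ν 0) U (𝓝 A) := tendsto_pi_nhds.2 fun j =>
    (hch j).2.tendsto_at hmem
  have hdiff : ∀ᶠ ν in U, ∀ j, DifferentiableOn ℂ (fun z => g ν j z / g ν i z) (ball 0 r) :=
    hgne.mono fun ν hν j => (hd ν j).differentiableOn.div (hd ν i).differentiableOn hν
  have hder : Tendsto (fun ν j => deriv (fun z => g ν j z / g ν i z) 0) U (𝓝 0) :=
    tendsto_pi_nhds.2 fun j => by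
      have := ((hch j).2.deriv (hdiff.mono fun ν hν => hν j) isOpen_ball).tendsto_at hmem
      rw [hcon j] at this
      exact this
  have hL : Tendsto (fun ν => fderiv ℝ (lineProj (ι := ι)) (y ν 0)) U
      (𝓝 (fderiv ℝ lineProj A)) :=
    ((contDiffAt_lineProj hA0).continuousAt_fderiv one_ne_zero).tendsto.comp hyA
  have hprod := hL.norm.mul hder.norm
  rw [norm_zero, mul_zero] at hprod
  refine absurd (ge_of_tendsto hprod ?_) (not_le.2 (zero_lt_one (α := ℝ)))
  filter_upwards [hgne, hdiff] with ν hν hdν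
  have hy0 : y ν 0 ≠ 0 := fun h => by
    have := congrFun h i
    simp [hy, hν 0 hmem] at this
  have hD : HasDerivAt (y ν) (fun j => deriv (fun z => g ν j z / g ν i z) 0) 0 :=
    hasDerivAt_pi.2 fun j => ((hdν j).differentiableAt (isOpen_ball.mem_nhds hmem)).hasDerivAt
  have hP := ((contDiffAt_lineProj hy0).differentiableAt one_ne_zero).hasFDerivAt
  have hcomp := hP.comp (0 : ℂ) (hD.hasFDerivAt.restrictScalars ℝ)
  have heq : (fun z => lineProj fun i => g ν i z) =ᶠ[𝓝 0] lineProj ∘ y ν := by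
    filter_upwards [isOpen_ball.mem_nhds hmem] with z hz
    have : y ν z = (g ν i z)⁻¹ • fun j => g ν j z := by
      funext j
      simp [hy, div_eq_inv_mul]
    simp only [Function.comp_apply, this, lineProj_smul (inv_ne_zero (hν z hz))]
  rw [← h1 ν, heq.fderiv_eq, hcomp.fderiv]
  refine (ContinuousLinearMap.opNorm_comp_le _ _).trans ?_
  rw [ContinuousLinearMap.norm_restrictScalars, ContinuousLinearMap.norm_toSpanSingleton]

/-- A nonvanishing holomorphic function on a disc is, up to the exponential of an entire function,
close to `1` on a smaller disc. -/
lemma exists_eq_exp_add_of_ne_zero {f : ℂ → ℂ} {R : ℝ} (hf : DifferentiableOn ℂ f (ball 0 R))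
    (h0 : ∀ z ∈ ball (0 : ℂ) R, f z ≠ 0) {r ε : ℝ} (hrR : r < R) (hR : 0 < R) (hε : 0 < ε) :
    ∃ q b : ℂ → ℂ, Differentiable ℂ q ∧ DifferentiableOn ℂ b (ball 0 R) ∧
      (∀ z ∈ ball (0 : ℂ) R, f z = Complex.exp (b z + q z)) ∧ ∀ z ∈ ball (0 : ℂ) r, ‖b z‖ ≤ ε := by
  have hlog : DifferentiableOn ℂ (fun z => deriv f z / f z) (ball 0 R) :=
    (hf.deriv isOpen_ball).div hf h0
  have hmem : (0 : ℂ) ∈ ball (0 : ℂ) R := mem_ball_self hR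
  obtain ⟨g, hg0, hg⟩ : ∃ g : ℂ → ℂ, Complex.exp (g 0) = f 0 ∧
      ∀ z ∈ ball (0 : ℂ) R, HasDerivAt g (deriv f z / f z) z := by
    obtain ⟨g, hg0, hg⟩ := hlog.isExactOn_ball.with_val_at 0 (Complex.log (f 0))
    exact ⟨g, by rw [hg0, Complex.exp_log (h0 0 hmem)], hg⟩
  have hexp : ∀ z ∈ ball (0 : ℂ) R, f z = Complex.exp (g z) := by
    have hder : ∀ z ∈ ball (0 : ℂ) R,
        HasDerivAt (fun z => f z * Complex.exp (-g z)) 0 z := fun z hz => by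
      have h1 := ((hf.differentiableAt (isOpen_ball.mem_nhds hz)).hasDerivAt).mul (hg z hz).neg.cexp
      refine h1.congr_deriv ?_
      have h2 : f z * (deriv f z / f z) = deriv f z := mul_div_cancel₀ _ (h0 z hz)
      simp only [Pi.neg_apply]
      linear_combination -Complex.exp (-g z) * h2
    intro z hz
    have hc : f z * Complex.exp (-g z) = f 0 * Complex.exp (-g 0) :=
      isOpen_ball.is_const_of_deriv_eq_zero (convex_ball (0 : ℂ) R).isPreconnected
      (fun z hz => (hder z hz).differentiableAt.differentiableWithinAt)
      (fun z hz => (hder z hz).deriv) hz hmem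
    rw [← hg0, ← Complex.exp_add, add_neg_cancel, Complex.exp_zero] at hc
    rw [← mul_one (Complex.exp (g z)), ← hc, mul_left_comm, ← Complex.exp_add, add_neg_cancel,
      Complex.exp_zero, mul_one]
  have hgd : DifferentiableOn ℂ g (ball 0 R) := fun z hz =>
    (hg z hz).differentiableAt.differentiableWithinAt
  rcases le_or_gt r 0 with hr | hr
  · refine ⟨0, g, differentiable_const 0, hgd, by simpa using hexp, fun z hz => ?_⟩
    rw [ball_eq_empty.2 hr] at hz
    exact hz.elim
  obtain ⟨r', hr', hr'R⟩ := exists_between hrR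
  lift r' to NNReal using (hr.trans hr').le
  lift r to NNReal using hr.le
  have hps := (hgd.mono (closedBall_subset_ball hr'R)).hasFPowerSeriesOnBall
    (by exact_mod_cast hr.trans hr')
  have htu := hps.tendstoUniformlyOn (r' := r) (by exact_mod_cast hr')
  obtain ⟨n, hn⟩ := (Metric.tendstoUniformlyOn_iff.1 htu ε hε).exists
  set q : ℂ → ℂ := fun z => (cauchyPowerSeries g 0 r').partialSum n z with hq
  have hqd : Differentiable ℂ q := by
    simp only [hq, FormalMultilinearSeries.partialSum]
    refine Differentiable.fun_sum fun k _ => ?_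
    simp only [FormalMultilinearSeries.apply_eq_pow_smul_coeff]
    fun_prop
  refine ⟨q, fun z => g z - q z, hqd, hgd.sub hqd.differentiableOn, fun z hz => ?_, fun z hz => ?_⟩
  · rw [hexp z hz, sub_add_cancel]
  · have := hn z hz
    rw [zero_add, dist_eq_norm] at this
    exact this.le

/-- **Weierstrass**: an entire function with prescribed zeros. -/
theorem exists_entire_of_order (d : ℂ → ℕ) (hd : ∀ R : ℝ, {p | d p ≠ 0 ∧ ‖p‖ ≤ R}.Finite) :
    ∃ E : ℂ → ℂ, Differentiable ℂ E ∧ ∀ p, ∃ u : ℂ → ℂ, AnalyticAt ℂ u p ∧ u p ≠ 0 ∧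
      ∀ᶠ z in 𝓝 p, E z = (z - p) ^ d p * u z := by
  classical
  set S : ℕ → Finset ℂ := fun N => (hd (N + 1)).toFinset with hS
  have hmemS : ∀ N p, p ∈ S N ↔ d p ≠ 0 ∧ ‖p‖ ≤ N + 1 := fun N p => by simp [hS]
  have hSmono : ∀ N, S N ⊆ S (N + 1) := fun N p hp => by
    rw [hmemS] at hp ⊢
    push_cast
    exact ⟨hp.1, by linarith [hp.2]⟩
  set P : ℕ → ℂ → ℂ := fun N z => ∏ p ∈ S N, (z - p) ^ d p with hP
  have hA : ∀ N : ℕ, ∃ q b : ℂ → ℂ, Differentiable ℂ q ∧ DifferentiableOn ℂ b (ball 0 (N + 1)) ∧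
      (∀ z ∈ ball (0 : ℂ) (N + 1), P (N + 1) z = P N z * Complex.exp (b z + q z)) ∧
      ∀ z ∈ ball (0 : ℂ) N, ‖b z‖ ≤ (1 / 2) ^ N := fun N => by
    obtain ⟨q, b, hq, hb, he, hbd⟩ := exists_eq_exp_add_of_ne_zero
      (f := fun z => ∏ p ∈ S (N + 1) \ S N, (z - p) ^ d p) (R := N + 1) (r := N) (ε := (1 / 2) ^ N)
      (by fun_prop) (fun z hz => Finset.prod_ne_zero_iff.2 fun p hp => pow_ne_zero _ fun h => by
        rw [Finset.mem_sdiff, hmemS, hmemS] at hp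
        rw [mem_ball_zero_iff, sub_eq_zero.1 h] at hz
        exact hp.2 ⟨hp.1.1, hz.le⟩) (by linarith) (by positivity) (by positivity)
    refine ⟨q, b, hq, hb, fun z hz => ?_, hbd⟩
    rw [← he z hz, hP, mul_comm]
    exact (Finset.prod_sdiff (hSmono N)).symm
  choose q b hq hb hPb hbd using hA
  set B : ℕ → ℂ → ℂ := fun N z => ∑' j, b (N + j) z with hB
  have hbound : ∀ (N : ℕ), ∀ j, ∀ z ∈ ball (0 : ℂ) N, ‖b (N + j) z‖ ≤ (1 / 2 : ℝ) ^ j := by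
    intro N j z hz
    refine (hbd (N + j) z (ball_subset_ball (by push_cast; linarith [j.cast_nonneg (α := ℝ)]) hz)).trans ?_
    exact pow_le_pow_of_le_one (by norm_num) (by norm_num) (Nat.le_add_left _ _)
  have hsummable : Summable fun j : ℕ => (1 / 2 : ℝ) ^ j := summable_geometric_two
  have hBd : ∀ N : ℕ, DifferentiableOn ℂ (B N) (ball 0 N) := fun N =>
    Complex.differentiableOn_tsum_of_summable_norm hsummable
      (fun j => (hb (N + j)).mono (ball_subset_ball (by
        push_cast; linarith [j.cast_nonneg (α := ℝ)]))) isOpen_ball (hbound N)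
  have hBsucc : ∀ N : ℕ, ∀ z ∈ ball (0 : ℂ) N, B N z = b N z + B (N + 1) z := fun N z hz => by
    have hs : Summable fun j => b (N + j) z :=
      Summable.of_norm_bounded hsummable fun j => hbound N j z hz
    simp only [hB]
    rw [hs.tsum_eq_zero_add, add_zero]
    congr 2
    funext j
    congr 1
    ring
  set E : ℕ → ℂ → ℂ := fun N z =>
    P N z * Complex.exp (B N z - ∑ j ∈ Finset.range N, q j z) with hE
  have hEsucc : ∀ N : ℕ, ∀ z ∈ ball (0 : ℂ) N, E (N + 1) z = E N z := fun N z hz => by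
    simp only [hE]
    rw [hPb N z (ball_subset_ball (by linarith) hz), hBsucc N z hz, Finset.sum_range_succ, mul_assoc,
      ← Complex.exp_add]
    congr 2
    ring
  have hEle : ∀ N M : ℕ, N ≤ M → ∀ z ∈ ball (0 : ℂ) N, E M z = E N z := fun N M hNM z hz => by
    induction M, hNM using Nat.le_induction with
    | base => rfl
    | succ M hNM ih =>
      rw [hEsucc M z (ball_subset_ball (by exact_mod_cast hNM) hz), ih]
  set F : ℂ → ℂ := fun z => E (⌊‖z‖⌋₊ + 1) z with hF
  have hFE : ∀ M : ℕ, ∀ z ∈ ball (0 : ℂ) M, F z = E M z := fun M z hz => by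
    rw [mem_ball_zero_iff] at hz
    refine (hEle (⌊‖z‖⌋₊ + 1) M ((Nat.floor_lt (norm_nonneg z)).2 hz) z ?_).symm
    rw [mem_ball_zero_iff]
    exact_mod_cast Nat.lt_floor_add_one ‖z‖
  have hPd : ∀ N, Differentiable ℂ (P N) := fun N => by
    simp only [hP]
    fun_prop
  have hed : ∀ N : ℕ, DifferentiableOn ℂ
      (fun z => Complex.exp (B N z - ∑ j ∈ Finset.range N, q j z)) (ball 0 N) := fun N =>
    ((hBd N).sub (Differentiable.fun_sum fun j _ => hq j).differentiableOn).cexp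
  have hnhds : ∀ p : ℂ, ball (0 : ℂ) (⌊‖p‖⌋₊ + 1 : ℕ) ∈ 𝓝 p := fun p => by
    refine isOpen_ball.mem_nhds (mem_ball_zero_iff.2 ?_)
    exact_mod_cast Nat.lt_floor_add_one ‖p‖
  refine ⟨F, fun p => ?_, fun p => ?_⟩
  · refine (((hPd (⌊‖p‖⌋₊ + 1)).differentiableOn.mul (hed (⌊‖p‖⌋₊ + 1))).differentiableAt (hnhds p)).congr_of_eventuallyEq ?_
    filter_upwards [hnhds p] with z hz using hFE _ z hz
  · set N := ⌊‖p‖⌋₊ + 1 with hN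
    refine ⟨fun z => (∏ p' ∈ (S N).erase p, (z - p') ^ d p') *
      Complex.exp (B N z - ∑ j ∈ Finset.range N, q j z), ?_, ?_, ?_⟩
    · refine AnalyticAt.mul ?_ ((hed N).analyticAt (hnhds p))
      exact Differentiable.analyticAt (by fun_prop) p
    · refine mul_ne_zero (Finset.prod_ne_zero_iff.2 fun p' hp' => pow_ne_zero _ ?_)
        (Complex.exp_ne_zero _)
      exact sub_ne_zero.2 (Finset.ne_of_mem_erase hp').symm
    · filter_upwards [hnhds p] with z hz
      rw [hFE N z hz]
      simp only [hE]
      rw [← mul_assoc]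
      congr 1
      by_cases hp : p ∈ S N
      · exact (Finset.mul_prod_erase (S N) (fun p' => (z - p') ^ d p') hp).symm
      · have hdp : d p = 0 := by
          by_contra h
          refine hp ((hmemS N p).2 ⟨h, ?_⟩)
          have := (Nat.lt_floor_add_one ‖p‖).le
          rw [hN]
          push_cast
          linarith
        rw [Finset.erase_eq_of_notMem hp, hdp, pow_zero, one_mul]

namespace IsProjectiveLimit

variable {ι : Type*} [Fintype ι] {U : Ultrafilter ℕ} {g : ℕ → ι → ℂ → ℂ} {Q : ℂ → ι → ι → ℂ}

lemma chart_analyticAt (hQ : IsProjectiveLimit U g Q) {i : ι} {p : ℂ} (hi : Q p i i ≠ 0) (j : ι) :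
    AnalyticAt ℂ (fun z => Q z j i / Q z i i) p := by
  obtain ⟨r, hr, -, -, h⟩ := hQ.chart i p hi
  exact (h j).1.analyticAt (ball_mem_nhds p hr)

lemma eventually_diag_ne_zero (hQ : IsProjectiveLimit U g Q) {i : ι} {p : ℂ} (hi : Q p i i ≠ 0) :
    ∀ᶠ z in 𝓝 p, Q z i i ≠ 0 := by
  obtain ⟨r, hr, h, -, -⟩ := hQ.chart i p hi
  filter_upwards [ball_mem_nhds p hr] with z hz using h z hz

lemma div_eq_zero_iff (hQ : IsProjectiveLimit U g Q) {i : ι} {z : ℂ} (hi : Q z i i ≠ 0) (j : ι) :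
    Q z j i / Q z i i = 0 ↔ Q z j j = 0 := by
  have h := hQ.mul_diag z i j j
  rw [hQ.conj_eq z j i, Complex.mul_conj] at h
  rw [_root_.div_eq_zero_iff, or_iff_left hi]
  constructor
  · intro h0
    rw [h0, map_zero, Complex.ofReal_zero] at h
    exact (mul_eq_zero.1 h).resolve_right hi
  · intro h0
    rw [h0, zero_mul] at h
    exact Complex.normSq_eq_zero.1 (by exact_mod_cast h.symm)

lemma eventually_diag_ne_zero_of_ne (hQ : IsProjectiveLimit U g Q) {i : ι} {p₀ : ℂ}
    (hi : Q p₀ i i ≠ 0) (p : ℂ) : ∀ᶠ z in 𝓝[≠] p, Q z i i ≠ 0 := by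
  have hdich : ∀ p, (∀ᶠ z in 𝓝 p, Q z i i = 0) ∨ ∀ᶠ z in 𝓝[≠] p, Q z i i ≠ 0 := fun p => by
    obtain ⟨l, hl⟩ := hQ.exists_diag_ne_zero p
    have he := hQ.eventually_diag_ne_zero hl
    refine (hQ.chart_analyticAt hl i).eventually_eq_zero_or_eventually_ne_zero.imp
      (fun h => ?_) (fun h => ?_)
    · filter_upwards [h, he] with z hz hz' using (hQ.div_eq_zero_iff hz' i).1 hz
    · filter_upwards [h, he.filter_mono nhdsWithin_le_nhds] with z hz hz'
      exact fun h0 => hz ((hQ.div_eq_zero_iff hz' i).2 h0)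
  have hclopen : IsClopen {p | ∀ᶠ z in 𝓝 p, Q z i i = 0} := by
    constructor
    · rw [← isOpen_compl_iff, isOpen_iff_mem_nhds]
      intro p hp
      have h := eventually_nhdsWithin_iff.1 ((hdich p).resolve_left hp)
      filter_upwards [eventually_eventually_nhds.2 h] with w hw hw0
      have h1 : ∀ᶠ z in 𝓝 w, z = p := by
        filter_upwards [hw, hw0] with z hz hz0
        by_contra hne
        exact hz hne hz0
      have h2 : ∀ᶠ z in 𝓝[≠] w, z ∈ ({p} : Set ℂ) := h1.filter_mono nhdsWithin_le_nhds
      have hwp : w = p := h1.self_of_nhds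
      subst hwp
      obtain ⟨z, hz, hz'⟩ := (h2.and self_mem_nhdsWithin).exists
      exact hz' hz
    · exact isOpen_setOfPred_eventually_nhds
  rcases isClopen_iff.1 hclopen with h | h
  · exact (hdich p).resolve_left fun hp => by
      have : p ∈ {p | ∀ᶠ z in 𝓝 p, Q z i i = 0} := hp
      rw [h] at this
      exact this
  · have : ∀ᶠ z in 𝓝 p₀, Q z i i = 0 := Set.eq_univ_iff_forall.1 h p₀
    exact (hi this.self_of_nhds).elim

/-- Near each point the limit curve has a holomorphic denominator of finite order. -/
lemma exists_local_order (hQ : IsProjectiveLimit U g Q) {i₀ : ι} {p₀ : ℂ} (hi : Q p₀ i₀ i₀ ≠ 0)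
    (p : ℂ) : ∃ (i : ι) (d : ℕ) (u : ℂ → ℂ), Q p i i ≠ 0 ∧ AnalyticAt ℂ u p ∧ u p ≠ 0 ∧
      ∀ᶠ z in 𝓝 p, Q z i₀ i / Q z i i = (z - p) ^ d * u z := by
  obtain ⟨i, hpi⟩ := hQ.exists_diag_ne_zero p
  have ha := hQ.chart_analyticAt hpi i₀
  have hne : analyticOrderAt (fun z => Q z i₀ i / Q z i i) p ≠ ⊤ := by
    rw [Ne, analyticOrderAt_eq_top]
    intro h0
    obtain ⟨z, ⟨hz1, hz2⟩, hz3⟩ := (((h0.and (hQ.eventually_diag_ne_zero hpi)).filter_mono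
      nhdsWithin_le_nhds).and (hQ.eventually_diag_ne_zero_of_ne hi p)).exists
    exact hz3 ((hQ.div_eq_zero_iff hz2 i₀).1 hz1)
  obtain ⟨d, hd⟩ := ENat.ne_top_iff_exists.1 hne
  obtain ⟨u, hu, hu0, he⟩ := (ha.analyticOrderAt_eq_natCast).1 hd.symm
  exact ⟨i, d, u, hpi, hu, hu0, by simpa using he⟩

/-- The limit curve is induced by entire functions without common zeros. -/
theorem exists_entire_lift (hQ : IsProjectiveLimit U g Q) :
    ∃ F : ι → ℂ → ℂ, (∀ j, Differentiable ℂ (F j)) ∧ (∀ z, ∃ i, F i z ≠ 0) ∧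
      ∀ z i j, F j z * Q z i i = F i z * Q z j i := by
  obtain ⟨i₀, hi₀⟩ := hQ.exists_diag_ne_zero 0
  choose c d u hc hu hu0 hcu using hQ.exists_local_order hi₀
  have hd0 : ∀ p, d p ≠ 0 → Q p i₀ i₀ = 0 := fun p hp => by
    rw [← hQ.div_eq_zero_iff (hc p) i₀, (hcu p).self_of_nhds, sub_self, zero_pow hp, zero_mul]
  have hfin : ∀ R : ℝ, {p | d p ≠ 0 ∧ ‖p‖ ≤ R}.Finite := fun R => by
    have hpt : ∀ p : ℂ, ∃ V ∈ 𝓝 p, ∀ z ∈ V, z ≠ p → Q z i₀ i₀ ≠ 0 := fun p =>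
      ⟨_, eventually_nhdsWithin_iff.1 (hQ.eventually_diag_ne_zero_of_ne hi₀ p), fun z hz h => hz h⟩
    choose V hV hVz using hpt
    obtain ⟨t, -, ht⟩ := (isCompact_closedBall (0 : ℂ) R).elim_nhds_subcover V fun p _ => hV p
    refine t.finite_toSet.subset fun p hp => ?_
    obtain ⟨x, hx, hpx⟩ := Set.mem_iUnion₂.1 (ht (mem_closedBall_zero_iff.2 hp.2))
    by_contra hcon
    exact hVz x p hpx (fun h => hcon (h ▸ hx)) (hd0 p hp.1)
  obtain ⟨E, -, hE⟩ := exists_entire_of_order d hfin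
  choose e he he0 hEe using hE
  have hlim : ∀ p, ∀ᶠ z in 𝓝 p, ∀ j,
      limUnder (𝓝[≠] z) (fun w => E w * (Q w j i₀ / Q w i₀ i₀)) =
        e p z / u p z * (Q z j (c p) / Q z (c p) (c p)) := fun p => by
    have hune : ∀ᶠ z in 𝓝 p, u p z ≠ 0 := (hu p).continuousAt.eventually_ne (hu0 p)
    have hloc : ∀ᶠ w in 𝓝 p, w ≠ p → ∀ j, E w * (Q w j i₀ / Q w i₀ i₀) =
        e p w / u p w * (Q w j (c p) / Q w (c p) (c p)) := by
      filter_upwards [hcu p, hEe p, hQ.eventually_diag_ne_zero (hc p), hune] with w h1 h2 h3 h4 hwp j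
      have hwp' : (w - p) ^ d p ≠ 0 := pow_ne_zero _ (sub_ne_zero.2 hwp)
      have h5 : Q w i₀ (c p) / Q w (c p) (c p) ≠ 0 := h1 ▸ mul_ne_zero hwp' h4
      have h6 : Q w i₀ i₀ ≠ 0 := fun h => h5 ((hQ.div_eq_zero_iff h3 i₀).2 h)
      have h7 : Q w i₀ (c p) ≠ 0 := fun h => h5 (by rw [h, zero_div])
      have h8 := hQ.mul_diag w i₀ j (c p)
      rw [h2]
      rw [div_eq_iff h3] at h1
      have h9 : Q w j i₀ / Q w i₀ i₀ = Q w j (c p) / Q w i₀ (c p) := by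
        rw [div_eq_div_iff h6 h7, h8]
      rw [h9, h1]
      field_simp
    have hana : ∀ᶠ z in 𝓝 p, AnalyticAt ℂ (e p) z ∧ AnalyticAt ℂ (u p) z ∧ u p z ≠ 0 ∧
        Q z (c p) (c p) ≠ 0 := by
      filter_upwards [(he p).eventually_analyticAt, (hu p).eventually_analyticAt, hune,
        hQ.eventually_diag_ne_zero (hc p)] with z h1 h2 h3 h4 using ⟨h1, h2, h3, h4⟩
    filter_upwards [eventually_eventually_nhds.2 hloc, hana] with z h1 ⟨h2, h3, h4, h5⟩ j
    have hcont : ContinuousAt (fun z => e p z / u p z * (Q z j (c p) / Q z (c p) (c p))) z :=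
      ((h2.div h3 h4).mul (hQ.chart_analyticAt h5 j)).continuousAt
    refine ((hcont.tendsto.mono_left nhdsWithin_le_nhds).congr' ?_).limUnder_eq
    have hp : ∀ᶠ w in 𝓝[≠] z, w ≠ p := by
      rcases eq_or_ne z p with rfl | hzp
      · exact self_mem_nhdsWithin
      · exact (isOpen_ne.mem_nhds hzp : {w | w ≠ p} ∈ 𝓝 z) |> fun h => nhdsWithin_le_nhds h
    filter_upwards [h1.filter_mono nhdsWithin_le_nhds, hp] with w hw hwp
    exact (hw hwp j).symm
  refine ⟨fun j z => limUnder (𝓝[≠] z) (fun w => E w * (Q w j i₀ / Q w i₀ i₀)), fun j p => ?_,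
    fun p => ⟨c p, ?_⟩, fun p i j => ?_⟩
  · refine AnalyticAt.differentiableAt (AnalyticAt.congr
      (((he p).div (hu p) (hu0 p)).mul (hQ.chart_analyticAt (hc p) j)) ?_)
    filter_upwards [hlim p] with z hz using (hz j).symm
  · simp only [(hlim p).self_of_nhds]
    rw [div_self (hc p), mul_one]
    exact div_ne_zero (he0 p) (hu0 p)
  · simp only [(hlim p).self_of_nhds]
    have := hQ.mul_diag p i j (c p)
    linear_combination (e p p / u p p / Q p (c p) (c p)) * this

end IsProjectiveLimit

lemma IsCompact.eventually_forall_mem_of_prod {α β : Type*} [TopologicalSpace β] {l : Filter α}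
    {K : Set β} (hK : IsCompact K) {P : α → β → Prop}
    (h : ∀ z ∈ K, ∀ᶠ q : α × β in l ×ˢ 𝓝 z, P q.1 q.2) : ∀ᶠ a in l, ∀ z ∈ K, P a z := by
  refine hK.induction_on (p := fun s => ∀ᶠ a in l, ∀ z ∈ s, P a z) (by simp)
    (fun s t hst ht => ht.mono fun a ha z hz => ha z (hst hz))
    (fun s t hs ht => by
      filter_upwards [hs, ht] with a h1 h2 z hz using hz.elim (h1 z) (h2 z)) fun z hz => ?_
  obtain ⟨A, hA, B, hB, hAB⟩ := Filter.eventually_prod_iff.1 (h z hz)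
  exact ⟨_, nhdsWithin_le_nhds hB, hA.mono fun a ha w hw => hAB ha hw⟩

lemma IsCompact.exists_forall_norm_le_of_tendsto_prod {α β : Type*} [TopologicalSpace β]
    {l : Filter α} {K : Set β} (hK : IsCompact K) {f : α → β → ℂ}
    (h : ∀ z ∈ K, ∃ c, Tendsto (fun q : α × β => f q.1 q.2) (l ×ˢ 𝓝 z) (𝓝 c)) :
    ∃ C : ℝ, ∀ᶠ a in l, ∀ z ∈ K, ‖f a z‖ ≤ C := by
  refine hK.induction_on (p := fun s => ∃ C : ℝ, ∀ᶠ a in l, ∀ z ∈ s, ‖f a z‖ ≤ C) ⟨0, by simp⟩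
    (fun s t hst ⟨C, ht⟩ => ⟨C, ht.mono fun a ha z hz => ha z (hst hz)⟩)
    (fun s t ⟨C, hs⟩ ⟨C', ht⟩ => ⟨max C C', by
      filter_upwards [hs, ht] with a h1 h2 z hz
      exact hz.elim (fun hz => (h1 z hz).trans (le_max_left _ _))
        fun hz => (h2 z hz).trans (le_max_right _ _)⟩) fun z hz => ?_
  obtain ⟨c, hc⟩ := h z hz
  have h1 : ∀ᶠ q : α × β in l ×ˢ 𝓝 z, ‖f q.1 q.2‖ ≤ ‖c‖ + 1 :=
    hc.norm.eventually (eventually_le_nhds (lt_add_one _))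
  obtain ⟨A, hA, B, hB, hAB⟩ := Filter.eventually_prod_iff.1 h1
  exact ⟨_, nhdsWithin_le_nhds hB, ‖c‖ + 1, hA.mono fun a ha w hw => hAB ha hw⟩

/-- A **Hurwitz** type statement: values close to `0` are attained near a zero of the limit. -/
lemma exists_tendsto_eq_of_tendsto_prod {U : Ultrafilter ℕ} {p : ℂ} {r R : ℝ} (hr : 0 < r)
    (hrR : r < R) {s : ℕ → ℂ → ℂ} {σ : ℂ → ℂ} {a : ℕ → ℂ}
    (hsd : ∀ᶠ ν in U, DifferentiableOn ℂ (s ν) (ball p R))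
    (hσd : ContinuousOn σ (closedBall p r))
    (hs : ∀ z ∈ closedBall p r, Tendsto (fun q : ℕ × ℂ => s q.1 q.2) (U ×ˢ 𝓝 z) (𝓝 (σ z)))
    (hσp : σ p = 0) (hσ0 : ∀ z ∈ closedBall p r, σ z = 0 → z = p) (ha : Tendsto a U (𝓝 0)) :
    ∃ q : ℕ → ℂ, Tendsto q U (𝓝 p) ∧ ∀ᶠ ν in U, q ν ∈ closedBall p r ∧ s ν (q ν) = a ν := by
  have hp : p ∈ closedBall p r := mem_closedBall_self hr.le
  have hsp : Tendsto (fun ν => s ν p) U (𝓝 0) := by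
    rw [← hσp]
    exact (hs p hp).comp (tendsto_id.prodMk tendsto_const_nhds)
  obtain ⟨x, hx, hxm⟩ := (isCompact_sphere p r).exists_isMinOn
    (NormedSpace.sphere_nonempty.2 hr.le) ((hσd.mono sphere_subset_closedBall).norm)
  set c := ‖σ x‖ with hc
  have hc0 : 0 < c := norm_pos_iff.2 fun h => by
    have := hσ0 x (sphere_subset_closedBall hx) h
    rw [this, mem_sphere, dist_self] at hx
    exact hr.ne hx
  have hlow : ∀ᶠ ν in U, ∀ z ∈ sphere p r, c / 2 ≤ ‖s ν z - s ν p‖ := by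
    refine (isCompact_sphere p r).eventually_forall_mem_of_prod fun z hz => ?_
    have h1 : Tendsto (fun q : ℕ × ℂ => ‖s q.1 q.2 - s q.1 p‖) (U ×ˢ 𝓝 z) (𝓝 ‖σ z - 0‖) :=
      ((hs z (sphere_subset_closedBall hz)).sub (hsp.comp tendsto_fst)).norm
    refine h1.eventually (eventually_ge_nhds ?_)
    have : c ≤ ‖σ z‖ := hxm hz
    rw [sub_zero]
    linarith
  have hdist : ∀ᶠ ν in U, a ν ∈ ball (s ν p) (c / 2 / 2) := by
    have h1 : Tendsto (fun ν => dist (a ν) (s ν p)) U (𝓝 (dist (0 : ℂ) 0)) := ha.dist hsp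
    rw [dist_self] at h1
    exact h1.eventually (eventually_lt_nhds (by positivity))
  have hex : ∀ᶠ ν in U, ∃ q ∈ closedBall p r, s ν q = a ν := by
    filter_upwards [hlow, hdist, hsd] with ν h1 h2 h3
    have hcl : DiffContOnCl ℂ (s ν) (ball p r) :=
      (h3.mono (closedBall_subset_ball hrR)).diffContOnCl_ball le_rfl
    refine hcl.ball_subset_image_closedBall hr h1 ?_ h2
    by_contra hcon
    rw [not_frequently] at hcon
    have hcst := (h3.analyticOnNhd isOpen_ball).eqOn_of_preconnected_of_eventuallyEq
      (analyticOnNhd_const (v := s ν p)) (convex_ball p R).isPreconnected (mem_ball_self (hr.trans hrR))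
      (hcon.mono fun z hz => not_not.1 hz)
    have := h1 x hx
    rw [hcst (closedBall_subset_ball hrR (sphere_subset_closedBall hx)), sub_self, norm_zero] at this
    linarith
  have hex' : ∀ ν, ∃ q, (∃ q ∈ closedBall p r, s ν q = a ν) → q ∈ closedBall p r ∧ s ν q = a ν :=
    fun ν => by
      by_cases h : ∃ q ∈ closedBall p r, s ν q = a ν
      · obtain ⟨q, hq⟩ := h
        exact ⟨q, fun _ => hq⟩
      · exact ⟨0, fun h' => (h h').elim⟩
  choose q hq using hex'
  have hqU : ∀ᶠ ν in U, q ν ∈ closedBall p r ∧ s ν (q ν) = a ν := hex.mono fun ν h => hq ν h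
  refine ⟨q, ?_, hqU⟩
  obtain ⟨y, hy, hqy⟩ := (isCompact_closedBall p r).ultrafilter_le_nhds (U.map q)
    (le_principal_iff.2 (hqU.mono fun ν h => h.1))
  have hqy' : Tendsto q U (𝓝 y) := hqy
  have h1 : Tendsto (fun ν => s ν (q ν)) U (𝓝 (σ y)) := (hs y hy).comp (tendsto_id.prodMk hqy')
  have h2 : Tendsto (fun ν => s ν (q ν)) U (𝓝 0) := ha.congr' (hqU.mono fun ν h => h.2.symm)
  rwa [hσ0 y hy (tendsto_nhds_unique h1 h2)] at hqy'

lemma eq_zero_of_forall_sum_mul_pow_eq_zero {n m : ℕ} (hm : n + 2 ≤ m) (a : Fin (n + 1) → ℂ)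
    (h : ∀ t : ℂ, ∑ i, a i * t ^ (m - 2 - (i : ℕ)) = 0) (i : Fin (n + 1)) : a i = 0 := by
  have hpoly : ∑ i, Polynomial.C (a i) * Polynomial.X ^ (m - 2 - (i : ℕ)) = 0 :=
    Polynomial.funext fun t => by simpa [Polynomial.eval_finsetSum] using h t
  have := congrArg (fun P => Polynomial.coeff P (m - 2 - (i : ℕ))) hpoly
  simp only [Polynomial.finsetSum_coeff, Polynomial.coeff_C_mul, Polynomial.coeff_X_pow,
    Polynomial.coeff_zero] at this
  rw [Finset.sum_eq_single i] at this
  · simpa using this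
  · intro j _ hj
    rw [if_neg, mul_zero]
    intro h
    have := i.2
    have := j.2
    exact hj (Fin.ext (by omega))
  · simp

/-- Local analysis of the degeneration of `v ^ m = s ^ m + ∑ ε ^ (i + 2) αᵢ s ^ (m - 2 - i) + …` to
`v = s`. -/
lemma eq_zero_of_perturbed_pow_eq {U : Ultrafilter ℕ} {n m : ℕ} (hm : n + 2 ≤ m) {p : ℂ}
    {r R : ℝ} (hr : 0 < r) (hrR : r < R) {ε : ℕ → ℂ} (hε : Tendsto ε U (𝓝 0))
    (hε0 : ∀ ν, ε ν ≠ 0) {s v b : ℕ → ℂ → ℂ} {a : Fin (n + 1) → ℕ → ℂ → ℂ}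
    {σ : ℂ → ℂ} {α : Fin (n + 1) → ℂ → ℂ}
    (hsd : ∀ᶠ ν in U, DifferentiableOn ℂ (s ν) (ball p R))
    (hvd : ∀ᶠ ν in U, DifferentiableOn ℂ (v ν) (ball p R))
    (hσd : ContinuousOn σ (closedBall p r))
    (hs : ∀ z ∈ closedBall p r, Tendsto (fun q : ℕ × ℂ => s q.1 q.2) (U ×ˢ 𝓝 z) (𝓝 (σ z)))
    (hv : ∀ z ∈ closedBall p r, Tendsto (fun q : ℕ × ℂ => v q.1 q.2) (U ×ˢ 𝓝 z) (𝓝 (σ z)))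
    (hb : ∀ z ∈ closedBall p r, Tendsto (fun q : ℕ × ℂ => b q.1 q.2) (U ×ˢ 𝓝 z) (𝓝 0))
    (ha : ∀ i, ∀ z ∈ closedBall p r,
      Tendsto (fun q : ℕ × ℂ => a i q.1 q.2) (U ×ˢ 𝓝 z) (𝓝 (α i z)))
    (heq : ∀ᶠ ν in U, ∀ z ∈ closedBall p r, v ν z ^ m = s ν z ^ m +
      ∑ i : Fin (n + 1), ε ν ^ ((i : ℕ) + 2) * a i ν z * s ν z ^ (m - 2 - (i : ℕ)) +
      ε ν ^ m * b ν z)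
    (hσp : σ p = 0) (hσ0 : ∀ z ∈ closedBall p r, σ z = 0 → z = p) (i : Fin (n + 1)) :
    α i p = 0 := by
  set A : ℕ → ℂ → ℂ := fun ν z => ∑ i : Fin (n + 1), ε ν ^ (i : ℕ) * a i ν z *
    s ν z ^ (m - 2 - (i : ℕ)) + ε ν ^ (m - 2) * b ν z with hA
  set S : ℕ → ℂ → ℂ := fun ν z => ∑ j ∈ Finset.range m, v ν z ^ j * s ν z ^ (m - 1 - j) with hS
  set τ : ℕ → ℂ → ℂ := fun ν z => (v ν z - s ν z) / ε ν ^ 2 with hτ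
  have hεp : ∀ z, Tendsto (fun q : ℕ × ℂ => ε q.1) ((U : Filter ℕ) ×ˢ 𝓝 z) (𝓝 0) := fun z =>
    hε.comp tendsto_fst
  have hAlim : ∀ z ∈ closedBall p r, ∃ c,
      Tendsto (fun q : ℕ × ℂ => A q.1 q.2) (U ×ˢ 𝓝 z) (𝓝 c) := fun z hz =>
    ⟨_, (tendsto_finsetSum _ fun (i : Fin (n + 1)) _ => (((hεp z).pow (i : ℕ)).mul (ha i z hz)).mul
      ((hs z hz).pow _)).add (((hεp z).pow (m - 2)).mul (hb z hz))⟩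
  have hSlim : ∀ z ∈ closedBall p r,
      Tendsto (fun q : ℕ × ℂ => S q.1 q.2) (U ×ˢ 𝓝 z) (𝓝 (m * σ z ^ (m - 1))) := fun z hz => by
    have h1 : Tendsto (fun q : ℕ × ℂ => S q.1 q.2) (U ×ˢ 𝓝 z)
        (𝓝 (∑ j ∈ Finset.range m, σ z ^ j * σ z ^ (m - 1 - j))) :=
      tendsto_finsetSum _ fun j _ => ((hv z hz).pow j).mul ((hs z hz).pow _)
    convert h1 using 2
    rw [Finset.sum_congr rfl (g := fun _ => σ z ^ (m - 1)), Finset.sum_const, Finset.card_range,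
      nsmul_eq_mul]
    intro j hj
    have := Finset.mem_range.1 hj
    rw [← pow_add]
    congr 1
    omega
  have hτS : ∀ᶠ ν in U, ∀ z ∈ closedBall p r, τ ν z * S ν z = A ν z := by
    filter_upwards [heq] with ν h z hz
    have h1 : S ν z * (v ν z - s ν z) = v ν z ^ m - s ν z ^ m := geom_sum₂_mul _ _ _
    have h2 : ε ν ^ 2 * A ν z = v ν z ^ m - s ν z ^ m := by
      rw [h z hz, hA]
      simp only
      rw [mul_add, Finset.mul_sum, ← mul_assoc, ← pow_add, Nat.add_sub_cancel' (by omega),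
        add_assoc, add_sub_cancel_left]
      congr 1
      refine Finset.sum_congr rfl fun i _ => ?_
      ring
    have h3 : ε ν ^ 2 ≠ 0 := pow_ne_zero _ (hε0 ν)
    simp only [hτ]
    rw [div_mul_eq_mul_div, mul_comm (v ν z - s ν z), h1, ← h2, mul_div_cancel_left₀ _ h3]
  obtain ⟨B, hB⟩ : ∃ B : ℝ, ∀ᶠ ν in U, ∀ z ∈ sphere p r, ‖τ ν z‖ ≤ B := by
    have hne : ∀ z ∈ sphere p r, (m : ℂ) * σ z ^ (m - 1) ≠ 0 := fun z hz => by
      refine mul_ne_zero (by exact_mod_cast (by omega : m ≠ 0)) (pow_ne_zero _ fun h => ?_)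
      rw [hσ0 z (sphere_subset_closedBall hz) h, mem_sphere, dist_self] at hz
      exact hr.ne hz
    obtain ⟨B, hB⟩ := (isCompact_sphere p r).exists_forall_norm_le_of_tendsto_prod
      (l := U) (f := fun ν z => A ν z / S ν z) fun z hz => by
        obtain ⟨c, hc⟩ := hAlim z (sphere_subset_closedBall hz)
        exact ⟨_, hc.div (hSlim z (sphere_subset_closedBall hz)) (hne z hz)⟩
    have hS0 : ∀ᶠ ν in U, ∀ z ∈ sphere p r, S ν z ≠ 0 :=
      (isCompact_sphere p r).eventually_forall_mem_of_prod fun z hz =>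
        (hSlim z (sphere_subset_closedBall hz)).eventually_ne (hne z hz)
    refine ⟨B, ?_⟩
    filter_upwards [hB, hS0, hτS] with ν h1 h2 h3 z hz
    rw [← mul_div_cancel_right₀ (τ ν z) (h2 z hz), h3 z (sphere_subset_closedBall hz)]
    exact h1 z hz
  have hBall : ∀ᶠ ν in U, ∀ z ∈ closedBall p r, ‖τ ν z‖ ≤ B := by
    filter_upwards [hB, hsd, hvd] with ν h1 h2 h3 z hz
    have hd : DiffContOnCl ℂ (τ ν) (ball p r) :=
      (((h3.sub h2).div_const _).mono (closedBall_subset_ball hrR)).diffContOnCl_ball le_rfl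
    refine Complex.norm_le_of_forall_mem_frontier_norm_le isBounded_ball hd
      (fun w hw => h1 w (frontier_ball_subset_sphere hw)) ?_
    rwa [closure_ball p hr.ne']
  refine eq_zero_of_forall_sum_mul_pow_eq_zero hm (fun i => α i p) (fun t => ?_) i
  obtain ⟨q, hqp, hq⟩ := exists_tendsto_eq_of_tendsto_prod hr hrR hsd hσd hs hσp hσ0
    (a := fun ν => t * ε ν) (by simpa using hε.const_mul t)
  have hpm : p ∈ closedBall p r := mem_closedBall_self hr.le
  have hprod : Tendsto (fun ν => (ν, q ν)) U (U ×ˢ 𝓝 p) := tendsto_id.prodMk hqp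
  have hετ : Tendsto (fun ν => ε ν * τ ν (q ν)) U (𝓝 0) := by
    refine squeeze_zero_norm' (a := fun ν => ‖ε ν‖ * B) ?_ (by simpa using hε.norm.mul_const B)
    filter_upwards [hBall, hq] with ν h1 h2
    rw [norm_mul]
    exact mul_le_mul_of_nonneg_left (h1 _ h2.1) (norm_nonneg _)
  have key : ∀ᶠ ν in U, (t + ε ν * τ ν (q ν)) ^ m = t ^ m +
      ∑ i : Fin (n + 1), a i ν (q ν) * t ^ (m - 2 - (i : ℕ)) + b ν (q ν) := by
    filter_upwards [heq, hq] with ν h1 ⟨h2, h3⟩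
    have h4 := h1 _ h2
    have h5 : v ν (q ν) = ε ν * (t + ε ν * τ ν (q ν)) := by
      have h6 : τ ν (q ν) * ε ν ^ 2 = v ν (q ν) - s ν (q ν) :=
        div_mul_cancel₀ _ (pow_ne_zero _ (hε0 ν))
      rw [h3] at h6
      linear_combination -h6
    rw [h5, h3] at h4
    refine mul_left_cancel₀ (pow_ne_zero m (hε0 ν)) ?_
    rw [← mul_pow, h4, mul_add, mul_add, Finset.mul_sum]
    congr 2
    · ring
    · refine Finset.sum_congr rfl fun i _ => ?_
      have hi := i.2
      have : ε ν ^ m = ε ν ^ ((i : ℕ) + 2) * ε ν ^ (m - 2 - (i : ℕ)) := by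
        rw [← pow_add]
        congr 1
        omega
      rw [this, mul_pow]
      ring
  have hL : Tendsto (fun ν => (t + ε ν * τ ν (q ν)) ^ m) U (𝓝 ((t + 0) ^ m)) :=
    (hετ.const_add t).pow m
  have hRt : Tendsto (fun ν => t ^ m + ∑ i : Fin (n + 1), a i ν (q ν) * t ^ (m - 2 - (i : ℕ)) +
      b ν (q ν)) U (𝓝 (t ^ m + ∑ i : Fin (n + 1), α i p * t ^ (m - 2 - (i : ℕ)) + 0)) :=
    ((tendsto_finsetSum _ fun i _ => ((ha i p hpm).comp hprod).mul_const _).const_add _).add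
      ((hb p hpm).comp hprod)
  have := tendsto_nhds_unique hL (hRt.congr' (key.mono fun ν h => h.symm))
  linear_combination -this

/-- Analytic functions with equal `m`-th powers differ by a root of unity. -/
lemma exists_root_of_unity_mul_of_pow_eq {m : ℕ} (hm : m ≠ 0) {p : ℂ} {v σ : ℂ → ℂ}
    (hv : AnalyticAt ℂ v p) (hσ : AnalyticAt ℂ σ p) (h : ∀ᶠ z in 𝓝 p, v z ^ m = σ z ^ m) :
    ∃ ζ : ℂ, ζ ^ m = 1 ∧ ∀ᶠ z in 𝓝 p, v z = ζ * σ z := by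
  by_contra! hcon
  have hprim := Complex.isPrimitiveRoot_exp m hm
  have hne : ∀ ζ ∈ Polynomial.nthRootsFinset m (1 : ℂ), ∀ᶠ z in 𝓝[≠] p, v z - ζ * σ z ≠ 0 := by
    intro ζ hζ
    have hζ' := (Polynomial.mem_nthRootsFinset (Nat.pos_of_ne_zero hm) 1).1 hζ
    refine ((hv.sub (analyticAt_const.mul hσ)).eventually_eq_zero_or_eventually_ne_zero).resolve_left
      fun h0 => (hcon ζ hζ') (h0.mono fun z hz h1 => h1 (sub_eq_zero.1 hz))
  obtain ⟨z, hz1, hz2⟩ := ((Filter.eventually_all_finset _).2 hne |>.and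
    (h.filter_mono nhdsWithin_le_nhds)).exists
  have h3 := hprim.pow_sub_pow_eq_prod_sub_mul (v z) (σ z) (Nat.pos_of_ne_zero hm)
  rw [hz2, sub_self] at h3
  exact Finset.prod_ne_zero_iff.2 hz1 h3.symm

lemma pow_eq_pow_of_tendsto_perturbed {U : Filter ℕ} [U.NeBot] {n m : ℕ} (hm : n + 2 ≤ m)
    {ε : ℕ → ℂ} (hε : Tendsto ε U (𝓝 0)) {s v b : ℕ → ℂ} {a : Fin (n + 1) → ℕ → ℂ} {σ w : ℂ}
    {α : Fin (n + 1) → ℂ} (hs : Tendsto s U (𝓝 σ)) (hv : Tendsto v U (𝓝 w))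
    (hb : Tendsto b U (𝓝 0)) (ha : ∀ i, Tendsto (a i) U (𝓝 (α i)))
    (heq : ∀ᶠ ν in U, v ν ^ m = s ν ^ m +
      ∑ i : Fin (n + 1), ε ν ^ ((i : ℕ) + 2) * a i ν * s ν ^ (m - 2 - (i : ℕ)) +
      ε ν ^ m * b ν) : w ^ m = σ ^ m := by
  have hm0 : m ≠ 0 := by omega
  have h2 : Tendsto (fun ν => s ν ^ m + ∑ i : Fin (n + 1), ε ν ^ ((i : ℕ) + 2) * a i ν *
      s ν ^ (m - 2 - (i : ℕ)) + ε ν ^ m * b ν) U (𝓝 (σ ^ m + ∑ i : Fin (n + 1),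
      0 ^ ((i : ℕ) + 2) * α i * σ ^ (m - 2 - (i : ℕ)) + 0 ^ m * 0)) :=
    ((hs.pow m).add (tendsto_finsetSum _ fun i _ => ((hε.pow _).mul (ha i)).mul (hs.pow _))).add
      ((hε.pow m).mul hb)
  have := tendsto_nhds_unique (hv.pow m) (h2.congr' (heq.mono fun ν h => h.symm))
  simpa using this

theorem eq_zero_of_perturbed_pow {U : Ultrafilter ℕ} {n m : ℕ} (hm : n + 2 ≤ m) {p : ℂ}
    {R : ℝ} (hR : 0 < R) {ε : ℕ → ℂ} (hε : Tendsto ε U (𝓝 0))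
    (hε0 : ∀ ν, ε ν ≠ 0) {s v b : ℕ → ℂ → ℂ} {a : Fin (n + 1) → ℕ → ℂ → ℂ}
    {σ w : ℂ → ℂ} {α : Fin (n + 1) → ℂ → ℂ}
    (hsd : ∀ᶠ ν in U, DifferentiableOn ℂ (s ν) (ball p R))
    (hvd : ∀ᶠ ν in U, DifferentiableOn ℂ (v ν) (ball p R))
    (hσd : DifferentiableOn ℂ σ (ball p R)) (hwd : DifferentiableOn ℂ w (ball p R))
    (hs : ∀ z ∈ ball p R, Tendsto (fun q : ℕ × ℂ => s q.1 q.2) (U ×ˢ 𝓝 z) (𝓝 (σ z)))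
    (hv : ∀ z ∈ ball p R, Tendsto (fun q : ℕ × ℂ => v q.1 q.2) (U ×ˢ 𝓝 z) (𝓝 (w z)))
    (hb : ∀ z ∈ ball p R, Tendsto (fun q : ℕ × ℂ => b q.1 q.2) (U ×ˢ 𝓝 z) (𝓝 0))
    (ha : ∀ i, ∀ z ∈ ball p R,
      Tendsto (fun q : ℕ × ℂ => a i q.1 q.2) (U ×ˢ 𝓝 z) (𝓝 (α i z)))
    (heq : ∀ᶠ ν in U, ∀ z ∈ ball p R, v ν z ^ m = s ν z ^ m +
      ∑ i : Fin (n + 1), ε ν ^ ((i : ℕ) + 2) * a i ν z * s ν z ^ (m - 2 - (i : ℕ)) +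
      ε ν ^ m * b ν z)
    (hσp : σ p = 0) (hσ0 : ∀ᶠ z in 𝓝[≠] p, σ z ≠ 0) (i : Fin (n + 1)) :
    α i p = 0 := by
  have hm0 : m ≠ 0 := by omega
  have hpow : ∀ z ∈ ball p R, w z ^ m = σ z ^ m := fun z hz => by
    have hprod : Tendsto (fun ν : ℕ => (ν, z)) U ((U : Filter ℕ) ×ˢ 𝓝 z) :=
      tendsto_id.prodMk tendsto_const_nhds
    exact pow_eq_pow_of_tendsto_perturbed hm hε ((hs z hz).comp hprod) ((hv z hz).comp hprod)
      ((hb z hz).comp hprod) (fun i => (ha i z hz).comp hprod) (heq.mono fun ν h => h z hz)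
  have hnb := ball_mem_nhds p hR
  obtain ⟨ζ, hζ, hwσ⟩ := exists_root_of_unity_mul_of_pow_eq hm0 (hwd.analyticAt hnb)
    (hσd.analyticAt hnb) (Filter.eventually_of_mem hnb hpow)
  have hζ0 : ζ ≠ 0 := fun h => by simp [h, hm0] at hζ
  obtain ⟨r, hr, hrb⟩ := (nhds_basis_closedBall.eventually_iff).1
    ((hwσ.and (eventually_nhdsWithin_iff.1 hσ0)).and (ball_mem_nhds p hR))
  have hsub : closedBall p r ⊆ ball p R := fun z hz => (hrb hz).2
  have hrR : r < R := by
    have : p + r ∈ ball p R := hsub (by simp [mem_closedBall, dist_eq_norm, abs_of_pos hr])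
    simpa [mem_ball, dist_eq_norm, abs_of_pos hr] using this
  refine eq_zero_of_perturbed_pow_eq hm hr hrR hε hε0 (v := fun ν z => ζ⁻¹ * v ν z) hsd
    (hvd.mono fun ν h => h.const_mul _) (hσd.continuousOn.mono hsub) (fun z hz => hs z (hsub hz))
    (fun z hz => ?_) (fun z hz => hb z (hsub hz)) (fun i z hz => ha i z (hsub hz)) ?_ hσp
    (fun z hz h0 => ?_) i
  · have h1 := (hv z (hsub hz)).const_mul ζ⁻¹
    rwa [(hrb hz).1.1, inv_mul_cancel_left₀ hζ0] at h1
  · filter_upwards [heq] with ν h z hz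
    rw [mul_pow, inv_pow, hζ, inv_one, one_mul]
    exact h z (hsub hz)
  · by_contra hne
    exact (hrb hz).1.2 hne h0

lemma MvPolynomial.IsHomogeneous.eval_mul_left {ι : Type*} [Fintype ι] {φ : MvPolynomial ι ℂ}
    {d : ℕ} (h : φ.IsHomogeneous d) (c : ℂ) (x : ι → ℂ) :
    eval (fun i => c * x i) φ = c ^ d * eval x φ := by
  rw [eval_eq', eval_eq', Finset.mul_sum]
  refine Finset.sum_congr rfl fun e he => ?_
  have hdeg : ∑ i, e i = d := by
    have := h (mem_support_iff.1 he)
    rwa [Finsupp.weight_apply, Finsupp.sum_fintype _ _ (by simp),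
      Finset.sum_congr rfl fun i _ => by rw [Pi.one_apply, smul_eq_mul, mul_one]] at this
  simp only [mul_pow, Finset.prod_mul_distrib, Finset.prod_pow_eq_pow_sum, hdeg]
  ring

lemma MvPolynomial.differentiable_eval {ι : Type*} [Fintype ι] (φ : MvPolynomial ι ℂ) :
    Differentiable ℂ fun x : ι → ℂ => eval x φ := by
  simp only [eval_eq']
  fun_prop

/-- The coefficients of the diagonal perturbations of `H` that are singular at a point of the
coordinate torus with support `I`. -/
noncomputable def singularCoeff {ι : Type*} [DecidableEq ι] (H : MvPolynomial ι ℂ) (d : ℕ)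
    (I : Finset ι) (p : ι → ℂ) : ι → ℂ := fun i =>
  if i ∈ I then -eval (fun j => if j ∈ I then p j else 0) (pderiv i H) / (d * p i ^ (d - 1))
  else p i

lemma volume_image_singularCoeff {ι : Type*} [Fintype ι] [DecidableEq ι] {H : MvPolynomial ι ℂ}
    {d : ℕ} (hH : H.IsHomogeneous d) (hd : d ≠ 0) {I : Finset ι} (hI : I.Nonempty) :
    MeasureTheory.volume (singularCoeff H d I '' {p | ∀ i ∈ I, p i ≠ 0}) = 0 := by
  have hdiff : ∀ p ∈ {p : ι → ℂ | ∀ i ∈ I, p i ≠ 0},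
      DifferentiableAt ℝ (singularCoeff H d I) p := by
    intro p hp
    refine DifferentiableAt.restrictScalars ℝ (𝕜' := ℂ) ?_
    refine differentiableAt_pi.2 fun i => ?_
    by_cases hi : i ∈ I
    · simp only [singularCoeff, if_pos hi, div_eq_mul_inv]
      have hden : DifferentiableAt ℂ (fun p : ι → ℂ => (d : ℂ) * p i ^ (d - 1)) p := by fun_prop
      refine DifferentiableAt.mul ?_ (hden.fun_inv
        (mul_ne_zero (by exact_mod_cast hd) (pow_ne_zero _ (hp i hi))))
      refine DifferentiableAt.neg ((differentiable_eval (pderiv i H)).differentiableAt.comp p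
        (differentiableAt_pi.2 fun j => ?_))
      split_ifs <;> fun_prop
    · simp only [singularCoeff, if_neg hi]
      fun_prop
  refine MeasureTheory.addHaar_image_eq_zero_of_det_fderivWithin_eq_zero MeasureTheory.volume
    (f' := fderiv ℝ (singularCoeff H d I))
    (fun p hp => (hdiff p hp).hasFDerivAt.hasFDerivWithinAt) fun p hp => ?_
  set v : ι → ℂ := fun i => if i ∈ I then p i else 0 with hv
  have hv0 : v ≠ 0 := fun h => by
    obtain ⟨i, hi⟩ := hI
    have := congrFun h i
    simp only [hv, if_pos hi, Pi.zero_apply] at this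
    exact hp i hi this
  have hline : HasDerivAt (fun t : ℝ => singularCoeff H d I (p + t • v))
      (fderiv ℝ (singularCoeff H d I) p v) 0 := (hdiff p hp).hasFDerivAt.hasLineDerivAt v
  have hconst : ∀ᶠ t : ℝ in 𝓝 0, singularCoeff H d I (p + t • v) = singularCoeff H d I p := by
    filter_upwards [lt_mem_nhds (show (-1 : ℝ) < 0 by norm_num)] with t ht
    have ht0 : (1 + t : ℂ) ≠ 0 := by
      have : (1 + t : ℝ) ≠ 0 := by linarith
      exact_mod_cast this
    have hpt : (fun j => if j ∈ I then (p + t • v) j else 0) =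
        fun j => (1 + t : ℂ) * if j ∈ I then p j else 0 := by
      funext j
      by_cases hj : j ∈ I
      · simp [hv, hj]
        ring
      · simp [hj]
    funext i
    by_cases hi : i ∈ I
    · simp only [singularCoeff, if_pos hi, hpt, hH.pderiv.eval_mul_left]
      have h1 : (p + t • v) i = (1 + t) * p i := by
        simp [hv, hi]
        ring
      rw [h1, mul_pow]
      have hpi := hp i hi
      have hdc : (d : ℂ) ≠ 0 := by exact_mod_cast hd
      field_simp
    · simp [singularCoeff, hi, hv]
  have hzero : fderiv ℝ (singularCoeff H d I) p v = 0 := by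
    rw [← hline.deriv, Filter.EventuallyEq.deriv_eq hconst, deriv_const]
  rw [ContinuousLinearMap.det, LinearMap.det_eq_zero_iff_ker_ne_bot]
  intro hker
  refine hv0 ((Submodule.mem_bot ℝ).1 (hker ▸ ?_))
  exact LinearMap.mem_ker.2 hzero

/-- **Bertini**: a small generic diagonal perturbation of a homogeneous polynomial is smooth. -/
theorem exists_smooth_diagonal_perturbation {q : ℕ} (H : MvPolynomial (Fin q) ℂ) {d : ℕ}
    (hd : d ≠ 0) (hH : H.IsHomogeneous d) {η : ℝ} (hη : 0 < η) :
    ∃ c : Fin q → ℂ, (∀ i, ‖c i‖ ≤ η) ∧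
      IsSmoothHypersurface (H + ∑ i, C (c i) * X i ^ d) := by
  have hnull : MeasureTheory.volume (⋃ I ∈ {I : Finset (Fin q) | I.Nonempty},
      singularCoeff H d I '' {p | ∀ i ∈ I, p i ≠ 0}) = 0 :=
    (MeasureTheory.measure_biUnion_null_iff (Set.to_countable _)).2 fun I hI =>
      volume_image_singularCoeff hH hd hI
  obtain ⟨c, hc, hcη⟩ := (MeasureTheory.Measure.dense_of_ae
    (MeasureTheory.measure_eq_zero_iff_ae_notMem.1 hnull)).exists_mem_open
    (isOpen_ball (x := (0 : Fin q → ℂ)) (ε := η)) ⟨0, mem_ball_self hη⟩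
  refine ⟨c, fun i => (norm_le_pi_norm c i).trans (mem_ball_zero_iff.1 hcη).le, fun x hx _ => ?_⟩
  by_contra! hcon
  refine hc (Set.mem_iUnion₂.2 ⟨Finset.univ.filter fun i => x i ≠ 0, ?_,
    fun i => if x i ≠ 0 then x i else c i, fun i hi => ?_, ?_⟩)
  · obtain ⟨i, hi⟩ := Function.ne_iff.1 hx
    exact ⟨i, by simpa using hi⟩
  · have hxi : x i ≠ 0 := by simpa using hi
    simp [hxi]
  · funext i
    have hxx : (fun j => if j ∈ Finset.univ.filter (fun i => x i ≠ 0) then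
        (if x j ≠ 0 then x j else c j) else 0) = x := by
      funext j
      by_cases hj : x j = 0 <;> simp [hj]
    by_cases hi : x i = 0
    · simp [singularCoeff, hi]
    · have hi' : i ∈ Finset.univ.filter (fun i => x i ≠ 0) := by simpa using hi
      simp only [singularCoeff, if_pos hi', hxx]
      have h1 := hcon i
      have h2 : eval x (pderiv i (∑ j, C (c j) * X j ^ d)) = c i * (d * x i ^ (d - 1)) := by
        rw [map_sum, map_sum, Finset.sum_eq_single i]
        · simp
        · intro j _ hj
          simp [pderiv_X_of_ne hj]
        · simp
      rw [map_add, map_add, h2] at h1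
      have hdc : (d : ℂ) ≠ 0 := by exact_mod_cast hd
      rw [if_pos hi, div_eq_iff (mul_ne_zero hdc (pow_ne_zero _ hi))]
      linear_combination -h1

/-- The polynomial `s ^ m + ∑ ε ^ (i + 2) zᵢ ^ ((i + 2) k) s ^ (m - 2 - i)`. -/
noncomputable def perturbedPow {n : ℕ} (s : MvPolynomial (Fin (n + 1)) ℂ) (k m : ℕ) (ε : ℂ) :
    MvPolynomial (Fin (n + 1)) ℂ :=
  s ^ m + ∑ i : Fin (n + 1),
    C (ε ^ ((i : ℕ) + 2)) * X i ^ (k * ((i : ℕ) + 2)) * s ^ (m - 2 - (i : ℕ))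

lemma isHomogeneous_perturbedPow {n k m : ℕ} (hm : n + 2 ≤ m) {s : MvPolynomial (Fin (n + 1)) ℂ}
    (hs : s.IsHomogeneous k) (ε : ℂ) : (perturbedPow s k m ε).IsHomogeneous (k * m) := by
  refine (hs.pow m).add (IsHomogeneous.sum _ _ _ fun i _ => ?_)
  have hi := i.2
  have h := (((isHomogeneous_X ℂ i).pow (k * ((i : ℕ) + 2))).C_mul (ε ^ ((i : ℕ) + 2))).mul
    (hs.pow (m - 2 - (i : ℕ)))
  rwa [one_mul, ← mul_add, show (i : ℕ) + 2 + (m - 2 - (i : ℕ)) = m by omega] at h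

lemma isHomogeneous_diagonal {n d : ℕ} (c : Fin (n + 1) → ℂ) :
    (∑ i, C (c i) * X i ^ d : MvPolynomial (Fin (n + 1)) ℂ).IsHomogeneous d :=
  IsHomogeneous.sum _ _ _ fun i _ => by
    have := ((isHomogeneous_X ℂ i).pow d).C_mul (c i)
    rwa [one_mul] at this

lemma eval_cyclicCover {n d : ℕ} (G : MvPolynomial (Fin (n + 1)) ℂ) (x : Fin (n + 2) → ℂ) :
    eval x (X (Fin.last (n + 1)) ^ d - rename Fin.castSucc G) =
      x (Fin.last (n + 1)) ^ d - eval (fun i => x (Fin.castSucc i)) G := by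
  rw [map_sub, map_pow, eval_X, eval_rename]
  rfl

lemma IsSmoothHypersurface.cyclicCover {n d : ℕ} (hd : 2 ≤ d) {G : MvPolynomial (Fin (n + 1)) ℂ}
    (hG : IsSmoothHypersurface G) :
    IsSmoothHypersurface (X (Fin.last (n + 1)) ^ d - rename Fin.castSucc G :
      MvPolynomial (Fin (n + 2)) ℂ) := by
  intro x hx hx0
  by_contra! hcon
  have hlast : x (Fin.last (n + 1)) = 0 := by
    have h1 := hcon (Fin.last (n + 1))
    have h2 : pderiv (Fin.last (n + 1)) (rename Fin.castSucc G : MvPolynomial (Fin (n + 2)) ℂ) = 0 := by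
      classical
      refine pderiv_eq_zero_of_notMem_vars fun h => ?_
      obtain ⟨i, -, hi⟩ := Finset.mem_image.1 (vars_rename _ _ h)
      exact (Fin.castSucc_lt_last i).ne hi
    rw [map_sub, h2, sub_zero, pderiv_pow, pderiv_X_self] at h1
    simp only [map_mul, map_pow, eval_X, map_natCast, mul_one] at h1
    have hdc : (d : ℂ) ≠ 0 := by exact_mod_cast (by omega : d ≠ 0)
    exact eq_zero_of_pow_eq_zero ((mul_eq_zero.1 h1).resolve_left hdc)
  rw [eval_cyclicCover, hlast, zero_pow (by omega), zero_sub, neg_eq_zero] at hx0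
  obtain ⟨i, hi⟩ := hG (fun i => x (Fin.castSucc i)) (fun h => hx (by
    funext j
    refine Fin.lastCases hlast (fun i => ?_) j
    exact congrFun h i)) hx0
  refine hi ?_
  have h1 := hcon (Fin.castSucc i)
  rw [map_sub, pderiv_rename (Fin.castSucc_injective _), pderiv_pow,
    pderiv_X_of_ne (Fin.castSucc_lt_last i).ne', mul_zero, zero_sub, map_neg, neg_eq_zero,
    eval_rename] at h1
  exact h1

lemma Differentiable.eq_of_pow_eq_const {f : ℂ → ℂ} (hf : Differentiable ℂ f) {d : ℕ} (hd : d ≠ 0)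
    {A : ℂ} (h : ∀ z, f z ^ d = A) (z : ℂ) : f z = f 0 := by
  rcases eq_or_ne A 0 with rfl | hA
  · rw [eq_zero_of_pow_eq_zero (h z), eq_zero_of_pow_eq_zero (h 0)]
  · refine is_const_of_deriv_eq_zero hf (fun w => ?_) z 0
    have h1 := (hf w).hasDerivAt.fun_pow d
    have h2 : (fun z => f z ^ d) = fun _ => A := funext h
    rw [h2] at h1
    have h3 := h1.unique (hasDerivAt_const w A)
    have hfw : f w ≠ 0 := fun h0 => hA (by rw [← h w, h0, zero_pow hd])
    exact (mul_eq_zero.1 h3).resolve_left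
      (mul_ne_zero (by exact_mod_cast hd) (pow_ne_zero _ hfw))

lemma exists_const_mul_of_pow_eq {n k m : ℕ} (hkm : k * m ≠ 0) {s : MvPolynomial (Fin (n + 1)) ℂ}
    (hs : s.IsHomogeneous k) {F : Fin (n + 2) → ℂ → ℂ} (hF : ∀ j, Differentiable ℂ (F j))
    (hF0 : ∀ z, ∃ i : Fin (n + 1), F i.castSucc z ≠ 0)
    (heq : ∀ z, F (Fin.last (n + 1)) z ^ (k * m) = eval (fun i : Fin (n + 1) => F i.castSucc z) s ^ m)
    {c : Fin (n + 1) → ℂ} {u : ℂ → ℂ} (hu : Differentiable ℂ u)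
    (hcu : ∀ (i : Fin (n + 1)) z, F i.castSucc z = c i * u z) :
    ∃ c' : Fin (n + 2) → ℂ, ∀ j z, F j z = c' j * u z := by
  have hu0 : ∀ z, u z ≠ 0 := fun z h => by
    obtain ⟨i, hi⟩ := hF0 z
    exact hi (by rw [hcu, h, mul_zero])
  have hconst := Differentiable.eq_of_pow_eq_const (f := fun z => F (Fin.last (n + 1)) z / u z)
    ((hF _).fun_div hu hu0) hkm (A := eval c s ^ m) fun z => by
      have h1 : eval (fun i : Fin (n + 1) => F i.castSucc z) s = u z ^ k * eval c s := by
        rw [← hs.eval_mul_left]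
        congr 2
        funext i
        rw [hcu, mul_comm]
      rw [div_pow, heq, h1, mul_pow, ← pow_mul, mul_div_cancel_left₀ _ (pow_ne_zero _ (hu0 z))]
  refine ⟨Fin.snoc c (F (Fin.last (n + 1)) 0 / u 0), fun j z => ?_⟩
  refine Fin.lastCases ?_ (fun i => ?_) j
  · rw [Fin.snoc_last, ← hconst z, div_mul_cancel₀ _ (hu0 z)]
  · rw [Fin.snoc_castSucc, hcu]

lemma pow_last_eq_of_chart {n k m : ℕ} (hm : n + 2 ≤ m) {s : MvPolynomial (Fin (n + 1)) ℂ}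
    (hs : s.IsHomogeneous k) {ε : ℂ} (hε0 : ε ≠ 0) {c : Fin (n + 1) → ℂ} {x : Fin (n + 2) → ℂ}
    (heq : x (Fin.last (n + 1)) ^ (k * m) = eval (fun i : Fin (n + 1) => x i.castSucc)
      (perturbedPow s k m ε + ∑ i, C (c i) * X i ^ (k * m))) (j : Fin (n + 2)) :
    ((x (Fin.last (n + 1)) / x j) ^ k) ^ m =
      eval (fun i : Fin (n + 1) => x i.castSucc / x j) s ^ m +
      ∑ i : Fin (n + 1), ε ^ ((i : ℕ) + 2) * (x i.castSucc / x j) ^ (k * ((i : ℕ) + 2)) *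
        eval (fun i : Fin (n + 1) => x i.castSucc / x j) s ^ (m - 2 - (i : ℕ)) +
      ε ^ m * ∑ i, c i / ε ^ m * (x i.castSucc / x j) ^ (k * m) := by
  have hG : (perturbedPow s k m ε + ∑ i, C (c i) * X i ^ (k * m)).IsHomogeneous (k * m) :=
    (isHomogeneous_perturbedPow hm hs ε).add (isHomogeneous_diagonal c)
  have h1 : (fun i : Fin (n + 1) => x i.castSucc / x j) =
      fun i => (x j)⁻¹ * x i.castSucc := funext fun i => div_eq_inv_mul _ _
  have h2 := hG.eval_mul_left (x j)⁻¹ fun i => x i.castSucc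
  rw [← heq, ← mul_pow, ← div_eq_inv_mul, ← h1] at h2
  rw [← pow_mul, ← h2, perturbedPow]
  simp only [map_add, map_sum, map_mul, map_pow, eval_C, eval_X]
  congr 1
  rw [Finset.mul_sum]
  refine Finset.sum_congr rfl fun i _ => ?_
  rw [← mul_assoc, mul_div_cancel₀ _ (pow_ne_zero _ hε0)]

lemma IsProjectiveLimit.exists_ball_tendsto_prod {ι : Type*} [Fintype ι] {U : Ultrafilter ℕ}
    {g : ℕ → ι → ℂ → ℂ} {Q : ℂ → ι → ι → ℂ} (hQ : IsProjectiveLimit U g Q)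
    (hd : ∀ ν i, Differentiable ℂ (g ν i)) {j : ι} {p : ℂ} (hj : Q p j j ≠ 0) :
    ∃ r > 0, (∀ z ∈ ball p r, Q z j j ≠ 0) ∧
      (∀ i, DifferentiableOn ℂ (fun z => Q z i j / Q z j j) (ball p r)) ∧
      (∀ᶠ ν in U, ∀ i, DifferentiableOn ℂ (fun z => g ν i z / g ν j z) (ball p r)) ∧
      ∀ i, ∀ z ∈ ball p r, Tendsto (fun q : ℕ × ℂ => g q.1 i q.2 / g q.1 j q.2) (U ×ˢ 𝓝 z)
        (𝓝 (Q z i j / Q z j j)) := by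
  obtain ⟨r, hr, hne, hg, h⟩ := hQ.chart j p hj
  refine ⟨r, hr, hne, fun i => (h i).1, ?_, fun i z hz => ?_⟩
  · filter_upwards [hg] with ν hν i
    exact (hd ν i).differentiableOn.fun_div (hd ν j).differentiableOn hν
  · exact (h i).2.tendsto_prod isOpen_ball hz
      (((h i).1.differentiableAt (isOpen_ball.mem_nhds hz)).continuousAt)

section Degeneration

variable {n k m : ℕ} {s : MvPolynomial (Fin (n + 1)) ℂ} {U : Ultrafilter ℕ} {ε : ℕ → ℂ}
  {g : ℕ → Fin (n + 2) → ℂ → ℂ} {Q : ℂ → Fin (n + 2) → Fin (n + 2) → ℂ}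
  {c : ℕ → Fin (n + 1) → ℂ}

lemma tendsto_eval_chart {α : Type*} {l : Filter α} {y : Fin (n + 1) → α → ℂ}
    {Y : Fin (n + 1) → ℂ} (hy : ∀ i, Tendsto (y i) l (𝓝 (Y i))) :
    Tendsto (fun q => eval (fun i => y i q) s) l (𝓝 (eval Y s)) :=
  ((differentiable_eval s).continuous.tendsto Y).comp (tendsto_pi_nhds.2 hy)

lemma tendsto_diagonal {α : Type*} {l : Filter α} {N : α → ℕ} (hN : Tendsto N l U)
    {y : Fin (n + 1) → α → ℂ} {Y : Fin (n + 1) → ℂ}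
    (hε : Tendsto ε U (𝓝 0)) (hε0 : ∀ ν, ε ν ≠ 0) (hc : ∀ ν i, ‖c ν i‖ ≤ ‖ε ν‖ ^ (m + 1)) (d : ℕ)
    (hy : ∀ i, Tendsto (y i) l (𝓝 (Y i))) :
    Tendsto (fun q => ∑ i, c (N q) i / ε (N q) ^ m * y i q ^ d) l (𝓝 0) := by
  have h1 : ∀ i, Tendsto (fun ν => c ν i / ε ν ^ m) U (𝓝 0) := fun i => by
    refine squeeze_zero_norm (fun ν => ?_) (tendsto_zero_iff_norm_tendsto_zero.1 hε)
    have h2 : 0 < ‖ε ν‖ := norm_pos_iff.2 (hε0 ν)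
    rw [norm_div, norm_pow, div_le_iff₀ (by positivity), ← pow_succ']
    exact hc ν i
  have h2 := tendsto_finsetSum (Finset.univ : Finset (Fin (n + 1))) fun i _ =>
    ((h1 i).comp hN).mul ((hy i).pow d)
  simpa using h2

/-- The curves on the perturbed hypersurfaces degenerate to a curve on
`{z_{n+1} ^ (k m) = s ^ m}`. -/
lemma pow_last_eq_of_limit (hm : n + 2 ≤ m) (hs : s.IsHomogeneous k) (hε : Tendsto ε U (𝓝 0))
    (hε0 : ∀ ν, ε ν ≠ 0) (hQ : IsProjectiveLimit U g Q) (hd : ∀ ν i, Differentiable ℂ (g ν i))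
    (hc : ∀ ν i, ‖c ν i‖ ≤ ‖ε ν‖ ^ (m + 1))
    (heq : ∀ ν z, g ν (Fin.last (n + 1)) z ^ (k * m) = eval (fun i : Fin (n + 1) => g ν i.castSucc z)
      (perturbedPow s k m (ε ν) + ∑ i, C (c ν i) * X i ^ (k * m)))
    {j : Fin (n + 2)} {z : ℂ} (hj : Q z j j ≠ 0) :
    ((Q z (Fin.last (n + 1)) j / Q z j j) ^ k) ^ m =
      eval (fun i : Fin (n + 1) => Q z i.castSucc j / Q z j j) s ^ m := by
  obtain ⟨r, hr, -, -, -, ht⟩ := hQ.exists_ball_tendsto_prod hd hj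
  have hprod : Tendsto (fun ν : ℕ => (ν, z)) U ((U : Filter ℕ) ×ˢ 𝓝 z) :=
    tendsto_id.prodMk tendsto_const_nhds
  have ht' := fun i => ht i z (mem_ball_self hr)
  have hs' : Tendsto (fun ν => eval (fun i : Fin (n + 1) => g ν i.castSucc z / g ν j z) s) U
      (𝓝 (eval (fun i : Fin (n + 1) => Q z i.castSucc j / Q z j j) s)) :=
    tendsto_eval_chart (y := fun (i : Fin (n + 1)) ν => g ν i.castSucc z / g ν j z)
      fun i => (ht' i.castSucc).comp hprod
  have hv : Tendsto (fun ν => (g ν (Fin.last (n + 1)) z / g ν j z) ^ k) U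
      (𝓝 ((Q z (Fin.last (n + 1)) j / Q z j j) ^ k)) := ((ht' _).comp hprod).pow k
  have hb : Tendsto (fun ν => ∑ i : Fin (n + 1),
      c ν i / ε ν ^ m * (g ν i.castSucc z / g ν j z) ^ (k * m)) U (𝓝 0) :=
    tendsto_diagonal (y := fun (i : Fin (n + 1)) ν => g ν i.castSucc z / g ν j z) tendsto_id
      hε hε0 hc (k * m) fun i => (ht' i.castSucc).comp hprod
  have ha : ∀ i : Fin (n + 1), Tendsto (fun ν => (g ν i.castSucc z / g ν j z) ^ (k * ((i : ℕ) + 2)))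
      U (𝓝 ((Q z i.castSucc j / Q z j j) ^ (k * ((i : ℕ) + 2)))) :=
    fun i => ((ht' i.castSucc).comp hprod).pow (k * ((i : ℕ) + 2))
  exact pow_eq_pow_of_tendsto_perturbed hm hε hs' hv hb ha (Eventually.of_forall fun ν =>
    pow_last_eq_of_chart (x := fun i => g ν i z) (c := c ν) hm hs (hε0 ν) (heq ν z) j)

/-- At an isolated zero of `s` along the limit curve, all the coordinates vanish. -/
lemma chart_eq_zero_of_isolated_zero (hm : n + 2 ≤ m) (hs : s.IsHomogeneous k)
    (hε : Tendsto ε U (𝓝 0))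
    (hε0 : ∀ ν, ε ν ≠ 0) (hQ : IsProjectiveLimit U g Q) (hd : ∀ ν i, Differentiable ℂ (g ν i))
    (hc : ∀ ν i, ‖c ν i‖ ≤ ‖ε ν‖ ^ (m + 1))
    (heq : ∀ ν z, g ν (Fin.last (n + 1)) z ^ (k * m) = eval (fun i : Fin (n + 1) => g ν i.castSucc z)
      (perturbedPow s k m (ε ν) + ∑ i, C (c ν i) * X i ^ (k * m)))
    {j : Fin (n + 2)} {p : ℂ} (hj : Q p j j ≠ 0)
    (hp : eval (fun i : Fin (n + 1) => Q p i.castSucc j / Q p j j) s = 0)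
    (hp' : ∀ᶠ z in 𝓝[≠] p, eval (fun i : Fin (n + 1) => Q z i.castSucc j / Q z j j) s ≠ 0)
    (i : Fin (n + 1)) : Q p i.castSucc j / Q p j j = 0 := by
  obtain ⟨r, hr, -, hY, hy, ht⟩ := hQ.exists_ball_tendsto_prod hd hj
  have hdiff : ∀ y : Fin (n + 1) → ℂ → ℂ, (∀ i, DifferentiableOn ℂ (y i) (ball p r)) →
      DifferentiableOn ℂ (fun z => eval (fun i => y i z) s) (ball p r) := fun y h =>
    (differentiable_eval s).comp_differentiableOn (differentiableOn_pi.2 h)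
  refine eq_zero_of_pow_eq_zero (n := k * ((i : ℕ) + 2)) ?_
  exact eq_zero_of_perturbed_pow hm hr hε hε0
    (s := fun ν z => eval (fun i : Fin (n + 1) => g ν i.castSucc z / g ν j z) s)
    (v := fun ν z => (g ν (Fin.last (n + 1)) z / g ν j z) ^ k)
    (b := fun ν z => ∑ i : Fin (n + 1), c ν i / ε ν ^ m * (g ν i.castSucc z / g ν j z) ^ (k * m))
    (a := fun i ν z => (g ν i.castSucc z / g ν j z) ^ (k * ((i : ℕ) + 2)))
    (σ := fun z => eval (fun i : Fin (n + 1) => Q z i.castSucc j / Q z j j) s)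
    (w := fun z => (Q z (Fin.last (n + 1)) j / Q z j j) ^ k)
    (α := fun i z => (Q z i.castSucc j / Q z j j) ^ (k * ((i : ℕ) + 2)))
    (hy.mono fun ν h => hdiff _ fun i => h i.castSucc)
    (hy.mono fun ν h => (h _).fun_pow k)
    (hdiff _ fun i => hY i.castSucc) ((hY _).fun_pow k)
    (fun z hz => tendsto_eval_chart fun i : Fin (n + 1) => ht i.castSucc z hz)
    (fun z hz => (ht _ z hz).pow k)
    (fun z hz => tendsto_diagonal tendsto_fst hε hε0 hc (k * m)
      fun i : Fin (n + 1) => ht i.castSucc z hz)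
    (fun i z hz => (ht i.castSucc z hz).pow _)
    (Eventually.of_forall fun ν z _ => pow_last_eq_of_chart (x := fun i => g ν i z) (c := c ν) hm hs
      (hε0 ν) (heq ν z) j) hp hp' i

theorem false_of_degeneration (hk : 1 ≤ k) (hm : n + 2 ≤ m) (hs : s.IsHomogeneous k)
    (hhyp : IsBrodyHyperbolicHypersurface s) (hcompl : IsBrodyHyperbolicComplement s)
    (hε : Tendsto ε U (𝓝 0))
    (hε0 : ∀ ν, ε ν ≠ 0) (hQ : IsProjectiveLimit U g Q) (hd : ∀ ν i, Differentiable ℂ (g ν i))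
    (h1 : ∀ ν, ‖fderiv ℝ (fun z => lineProj fun i => g ν i z) 0‖ = 1)
    (hc : ∀ ν i, ‖c ν i‖ ≤ ‖ε ν‖ ^ (m + 1))
    (heq : ∀ ν z, g ν (Fin.last (n + 1)) z ^ (k * m) = eval (fun i : Fin (n + 1) => g ν i.castSucc z)
      (perturbedPow s k m (ε ν) + ∑ i, C (c ν i) * X i ^ (k * m))) : False := by
  obtain ⟨F, hF, hF0, hFQ⟩ := hQ.exists_entire_lift
  have hchart : ∀ {j z}, Q z j j ≠ 0 → F j z ≠ 0 ∧ ∀ i, F i z = F j z * (Q z i j / Q z j j) := by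
    intro j z hj
    have h2 : ∀ i, F i z = F j z * (Q z i j / Q z j j) := fun i => by
      rw [← mul_div_assoc, eq_div_iff hj, hFQ]
    refine ⟨fun h0 => ?_, h2⟩
    obtain ⟨i, hi⟩ := hF0 z
    exact hi (by rw [h2, h0, zero_mul])
  have heval : ∀ {j z}, Q z j j ≠ 0 → eval (fun i : Fin (n + 1) => F i.castSucc z) s =
      F j z ^ k * eval (fun i : Fin (n + 1) => Q z i.castSucc j / Q z j j) s := by
    intro j z hj
    rw [← hs.eval_mul_left]
    congr 2
    funext i
    exact (hchart hj).2 _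
  have hpow : ∀ z, F (Fin.last (n + 1)) z ^ (k * m) =
      eval (fun i : Fin (n + 1) => F i.castSucc z) s ^ m := fun z => by
    obtain ⟨j, hj⟩ := hQ.exists_diag_ne_zero z
    rw [heval hj, (hchart hj).2 (Fin.last (n + 1)), pow_mul, mul_pow, mul_pow,
      pow_last_eq_of_limit hm hs hε hε0 hQ hd hc heq hj, mul_pow]
  have hkm : k * m ≠ 0 := Nat.mul_ne_zero (by omega) (by omega)
  have hF'0 : ∀ z, ∃ i : Fin (n + 1), F i.castSucc z ≠ 0 := fun z => by
    by_contra! hcon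
    have h2 : eval (fun i : Fin (n + 1) => F i.castSucc z) s = 0 := by
      have h3 := hs.eval_mul_left 0 fun i : Fin (n + 1) => F i.castSucc z
      rw [zero_pow (by omega), zero_mul] at h3
      rw [← h3]
      congr 2
      funext i
      rw [hcon i, mul_zero]
    have h3 := hpow z
    rw [h2, zero_pow (by omega)] at h3
    obtain ⟨i, hi⟩ := hF0 z
    revert hi
    exact Fin.lastCases (not_not.2 (eq_zero_of_pow_eq_zero h3)) (fun i => not_not.2 (hcon i)) i
  have hφd : Differentiable ℂ fun z => eval (fun i : Fin (n + 1) => F i.castSucc z) s :=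
    (differentiable_eval s).comp (differentiable_pi.2 fun i : Fin (n + 1) => hF i.castSucc)
  obtain ⟨b, u, hu, hbu⟩ : ∃ (b : Fin (n + 1) → ℂ) (u : ℂ → ℂ), Differentiable ℂ u ∧
      ∀ (i : Fin (n + 1)) z, F i.castSucc z = b i * u z := by
    by_cases hz : ∃ p, eval (fun i : Fin (n + 1) => F i.castSucc p) s = 0
    · obtain ⟨p, hp⟩ := hz
      refine hhyp (fun i => F i.castSucc) (fun i => hF _) hF'0 fun z => ?_
      have han : AnalyticOnNhd ℂ (fun z => eval (fun i : Fin (n + 1) => F i.castSucc z) s)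
        Set.univ := fun z _ => hφd.analyticAt z
      refine han.eqOn_zero_of_preconnected_of_eventuallyEq_zero isPreconnected_univ (Set.mem_univ p)
        (((han p (Set.mem_univ p)).eventually_eq_zero_or_eventually_ne_zero).resolve_right ?_)
        (Set.mem_univ z)
      intro hne
      obtain ⟨j, hj⟩ := hQ.exists_diag_ne_zero p
      obtain ⟨i, hi⟩ := hF'0 p
      refine hi ?_
      rw [(hchart hj).2, chart_eq_zero_of_isolated_zero hm hs hε hε0 hQ hd hc heq hj ?_ ?_ i,
        mul_zero]
      · rw [heval hj] at hp
        exact (mul_eq_zero.1 hp).resolve_left (pow_ne_zero _ (hchart hj).1)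
      · filter_upwards [hne, (hQ.eventually_diag_ne_zero hj).filter_mono nhdsWithin_le_nhds]
          with z hz hjz h0
        exact hz (by rw [heval hjz, h0, mul_zero])
    · exact hcompl (fun i => F i.castSucc) (fun i => hF _) hF'0 fun z h0 => hz ⟨z, h0⟩
  obtain ⟨b', hb'⟩ := exists_const_mul_of_pow_eq hkm hs hF hF'0 hpow hu hbu
  obtain ⟨j, hj⟩ := hQ.exists_diag_ne_zero 0
  obtain ⟨i, hi⟩ := hQ.exists_deriv_ne_zero hd h1 hj
  refine hi ?_
  have hconst : (fun z => Q z i j / Q z j j) =ᶠ[𝓝 0] fun _ => b' i / b' j := by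
    filter_upwards [hQ.eventually_diag_ne_zero hj] with z hjz
    obtain ⟨h2, h3⟩ := hchart hjz
    have h4 := h3 i
    rw [hb' j z] at h2
    rw [hb', hb'] at h4
    rw [eq_div_iff (left_ne_zero_of_mul h2)]
    refine mul_right_cancel₀ (right_ne_zero_of_mul h2) ?_
    linear_combination -h4
  rw [hconst.deriv_eq, deriv_const]

end Degeneration

end

/-- Theorem 4.1 (2): if there is a smooth Brody hyperbolic hypersurface of
degree `k` in ℙⁿ with Brody hyperbolic complement, and `δ` is a multiple of `k`
with `δ ≥ (n+2)k`, then there is a Brody hyperbolic smooth hypersurface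
`W = {z_{n+1}^δ = G(z_0, …, z_n)}` of degree `δ` in ℙ^{n+1}. -/
theorem exists_hyperbolic_cyclic_cover_hypersurface_complement
    (n k : ℕ) (hn : 1 ≤ n) (hk : 1 ≤ k)
    (hexists : ∃ s : MvPolynomial (Fin (n + 1)) ℂ, s ≠ 0 ∧ s.IsHomogeneous k ∧
      IsSmoothHypersurface s ∧ IsBrodyHyperbolicHypersurface s ∧
      IsBrodyHyperbolicComplement s)
    (δ : ℕ) (hkδ : k ∣ δ) (hδ : (n + 2) * k ≤ δ) :
    ∃ G : MvPolynomial (Fin (n + 1)) ℂ, G.IsHomogeneous δ ∧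
      IsSmoothHypersurface
        (X (Fin.last (n + 1)) ^ δ - rename Fin.castSucc G :
          MvPolynomial (Fin (n + 2)) ℂ) ∧
      IsBrodyHyperbolicHypersurface
        (X (Fin.last (n + 1)) ^ δ - rename Fin.castSucc G :
          MvPolynomial (Fin (n + 2)) ℂ) := by
  obtain ⟨s, -, hs, -, hhyp, hcompl⟩ := hexists
  obtain ⟨m, rfl⟩ := hkδ
  have hm : n + 2 ≤ m := by
    rw [mul_comm k m] at hδ
    exact Nat.le_of_mul_le_mul_right hδ hk
  have hkm : 2 ≤ k * m := le_trans (by omega) (Nat.le_mul_of_pos_left m hk)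
  set ε : ℕ → ℂ := fun ν => ((1 / ((ν : ℝ) + 1) : ℝ) : ℂ) with hεdef
  have hε0 : ∀ ν, ε ν ≠ 0 := fun ν => by
    rw [hεdef, Complex.ofReal_ne_zero]
    positivity
  have hε : Filter.Tendsto ε (Filter.hyperfilter ℕ) (nhds 0) :=
    (Complex.continuous_ofReal.tendsto' 0 0 rfl).comp
      (tendsto_one_div_add_atTop_nhds_zero_nat.mono_left Nat.hyperfilter_le_atTop)
  choose c hc hsm using fun ν => exists_smooth_diagonal_perturbation (perturbedPow s k m (ε ν))
    (by omega) (isHomogeneous_perturbedPow hm hs (ε ν))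
    (pow_pos (norm_pos_iff.2 (hε0 ν)) (m + 1))
  by_contra! hcon
  have hnh := fun ν => hcon _ ((isHomogeneous_perturbedPow hm hs (ε ν)).add
    (isHomogeneous_diagonal (c ν))) ((hsm ν).cyclicCover hkm)
  simp only [IsBrodyHyperbolicHypersurface, not_forall] at hnh
  choose h hhd hh0 hheq hhnc using hnh
  choose a b hab hab' using fun ν : ℕ =>
    exists_brody_reparametrization (hhd ν) (hh0 ν) (hhnc ν) (R := ν + 1) (by positivity)
  have hgd : ∀ ν i, Differentiable ℂ fun z => h ν i (a ν + b ν * z) := fun ν i =>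
    (hhd ν i).comp (by fun_prop)
  obtain ⟨Q, hQ⟩ := exists_isProjectiveLimit (Filter.hyperfilter ℕ)
    (g := fun ν i z => h ν i (a ν + b ν * z)) hgd (fun ν z => hh0 ν _) fun R => by
      obtain ⟨N, hN⟩ := exists_nat_ge R
      filter_upwards [Nat.hyperfilter_le_atTop (Filter.eventually_ge_atTop N)] with ν hν z hz
      refine hab' ν z ((mem_closedBall_zero_iff.1 hz).trans (hN.trans ?_))
      have : (N : ℝ) ≤ ν := by exact_mod_cast hν
      linarith
  refine false_of_degeneration hk hm hs hhyp hcompl hε hε0 hQ hgd hab hc fun ν z => ?_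
  have := hheq ν (a ν + b ν * z)
  rw [eval_cyclicCover] at this
  exact sub_eq_zero.1 this
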